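/- arXiv:2210.11116 — 14 statements merged into one kernel-verified Lean document; each statement's English description precedes it below -/
import Mathlib

section
/- Let n ≥ 5 and s be integers with 2 ≤ s ≤ ⌊(n−1)/2⌋. If s divides n, say n = λ·s, then the diameter of the circulant graph C_n(1,s) equals ⌊(λ + s − 1)/2⌋. -/
open SimpleGraph

/-- Moving `k` times along a jump of a circulant graph takes at most `k` steps. -/
lemma edist_add_nsmul_le {G : Type*} [AddCommGroup G] {S : Set G} {g : G}
    (hg : g ∈ S ∨ -g ∈ S) (u : G) (k : ℕ) :
    (circulantGraph S).edist u (u + k • g) ≤ k := by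
  induction k with
  | zero => simp
  | succ k ih =>
    refine ((circulantGraph S).edist_triangle (v := u + k • g)).trans ?_
    rw [Nat.cast_succ]
    refine add_le_add ih (edist_le_one_iff_adj_or_eq.2 ?_)
    by_cases h : u + k • g = u + (k + 1) • g
    · exact Or.inr h
    · refine Or.inl ?_
      have h1 : u + (k + 1) • g - (u + k • g) = g := by rw [succ_nsmul]; abel
      have h2 : u + k • g - (u + (k + 1) • g) = -g := by rw [succ_nsmul]; abel
      rw [circulantGraph_adj, h1, h2]
      exact ⟨h, hg.symm⟩

lemma edist_add_zsmul_le {G : Type*} [AddCommGroup G] {S : Set G} {g : G}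
    (hg : g ∈ S) (u : G) (k : ℤ) :
    (circulantGraph S).edist u (u + k • g) ≤ k.natAbs := by
  obtain ⟨m, rfl | rfl⟩ := k.eq_nat_or_neg
  · simpa using edist_add_nsmul_le (Or.inl hg) u m
  · simpa using edist_add_nsmul_le (g := -g) (Or.inr (by simpa using hg)) u m

lemma edist_circulantGraph_pair_le {G : Type*} [AddCommGroup G] (g h u v : G) (a b : ℤ)
    (hv : v - u = a • g + b • h) :
    (circulantGraph {g, h}).edist u v ≤ (a.natAbs + b.natAbs : ℕ) := by
  obtain rfl : v = u + a • g + b • h := by rw [add_assoc, ← hv]; abel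
  rw [Nat.cast_add]
  exact SimpleGraph.edist_triangle.trans
    (add_le_add (edist_add_zsmul_le (by simp) _ _) (edist_add_zsmul_le (by simp) _ _))

/-- The endpoints of a walk in a circulant graph with two jumps differ by a combination of the
jumps whose `ℓ¹` size is at most the length of the walk. -/
lemma exists_zsmul_of_walk {G : Type*} [AddCommGroup G] {g h u v : G}
    (p : (circulantGraph {g, h}).Walk u v) :
    ∃ a b : ℤ, v - u = a • g + b • h ∧ |a| + |b| ≤ p.length := by
  induction p with
  | nil => exact ⟨0, 0, by simp, by simp⟩
  | @cons u v w huv p ih =>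
    obtain ⟨a, b, hab, hle⟩ := ih
    have key : w - u = (w - v) + (v - u) := by abel
    have key' : w - u = (w - v) - (u - v) := by abel
    rw [circulantGraph_adj] at huv
    simp only [Set.mem_insert_iff, Set.mem_singleton_iff] at huv
    rw [Walk.length_cons]
    push_cast
    obtain ⟨-, (e | e) | (e | e)⟩ := huv
    · exact ⟨a - 1, b, by rw [key', hab, e, sub_zsmul, one_zsmul]; abel, by grind⟩
    · exact ⟨a, b - 1, by rw [key', hab, e, sub_zsmul, one_zsmul]; abel, by grind⟩
    · exact ⟨a + 1, b, by rw [key, hab, e, add_zsmul, one_zsmul]; abel, by grind⟩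
    · exact ⟨a, b + 1, by rw [key, hab, e, add_zsmul, one_zsmul]; abel, by grind⟩

lemma sub_abs_le_abs_add_mul {l b : ℤ} (hb : 0 ≤ b) (hbl : 2 * b ≤ l) (j m : ℤ) :
    b - |j| ≤ |b + j + m * l| := by
  rcases lt_trichotomy m 0 with hm | rfl | hm
  · have : m * l ≤ -l := by nlinarith
    grind
  · grind
  · have : l ≤ m * l := by nlinarith
    grind

/-- Every vector congruent to `(⌊s/2⌋, ⌊(l+s-1)/2⌋ - ⌊s/2⌋)` modulo the lattice spanned by `(s, -1)`
and `(0, l)` has `ℓ¹` norm at least `⌊(l+s-1)/2⌋`. -/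
lemma half_le_abs_add_abs {s l : ℤ} (hs : 2 ≤ s) (hl : 1 ≤ l) (k m : ℤ) :
    (l + s - 1) / 2 ≤ |s / 2 + k * s| + |(l + s - 1) / 2 - s / 2 - k + m * l| := by
  have hb : 0 ≤ (l + s - 1) / 2 - s / 2 := by omega
  have hbl : 2 * ((l + s - 1) / 2 - s / 2) ≤ l := by omega
  have h₁ := sub_abs_le_abs_add_mul hb hbl (-k) m
  rcases le_or_gt 0 k with hk | hk
  · have : k ≤ k * s := by nlinarith
    grind
  · have h₂ : s / 2 + k * s ≤ -(s - s / 2) + (k + 1) := by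
      have : (k + 1) * s ≤ k + 1 := by nlinarith
      linarith
    rcases Int.emod_two_eq_zero_or_one s with h | h
    · have h₄ : 2 * ((l + s - 1) / 2 - s / 2) + 1 ≤ l := by omega
      have h₅ : (l + s - 1) / 2 - s / 2 - (-k - 1) ≤
          |(l + s - 1) / 2 - s / 2 - k + m * l| := by
        rcases lt_trichotomy m 0 with hm | rfl | hm
        · have : m * l ≤ -l := by nlinarith
          grind
        · grind
        · have : l ≤ m * l := by nlinarith
          grind
      have h₆ : s - s / 2 = s / 2 := by omega
      grind
    · have h₆ : s - s / 2 = s / 2 + 1 := by omega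
      grind

/-- If `s` divides `n`, say `n = lam * s`, then the diameter of the circulant graph
`C_n(1,s)` equals `⌊(lam + s - 1)/2⌋`. -/
theorem diam_circulant_of_dvd (n s lam : ℕ) (hn : 5 ≤ n) (hs2 : 2 ≤ s)
    (hs : s ≤ (n - 1) / 2) (hlam : n = lam * s) :
    (circulantGraph ({1, (s : ZMod n)} : Set (ZMod n))).diam = (lam + s - 1) / 2 := by
  have hl : 1 ≤ lam := by
    rcases Nat.eq_zero_or_pos lam with rfl | h
    · omega
    · exact h
  have : NeZero n := ⟨by omega⟩
  suffices h : (circulantGraph ({1, (s : ZMod n)} : Set (ZMod n))).ediam =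
      ((lam + s - 1) / 2 : ℕ) by
    rw [diam, h, ENat.toNat_natCast]
  have hn0 : (lam : ZMod n) * s = 0 := by
    rw [← Nat.cast_mul, ← hlam, ZMod.natCast_self]
  apply le_antisymm
  · refine ediam_le_of_edist_le fun u v => ?_
    obtain ⟨x, hx, hxn⟩ : ∃ x : ℕ, v - u = x ∧ x < n :=
      ⟨(v - u).val, by simp, ZMod.val_lt _⟩
    have hdiv : (x : ZMod n) = (x % s : ℕ) + (x / s : ℕ) * s := by
      rw [← Nat.cast_mul, ← Nat.cast_add, Nat.mod_add_div']
    have ha : x % s < s := Nat.mod_lt _ (by omega)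
    have hb : x / s < lam := Nat.div_lt_of_lt_mul (by rwa [mul_comm, ← hlam])
    generalize x % s = a at *
    generalize x / s = b at *
    have h₁ := edist_circulantGraph_pair_le (1 : ZMod n) s u v a b (by simp [hx, hdiv])
    have h₂ := edist_circulantGraph_pair_le (1 : ZMod n) s u v (a - s) (b + 1 - lam) (by
      rw [hx, hdiv]
      simp only [zsmul_eq_mul]
      push_cast
      linear_combination hn0)
    rcases le_or_gt (a + b) ((lam + s - 1) / 2) with h | h
    · exact h₁.trans (by norm_cast)
    · exact h₂.trans (Nat.cast_le.2 (by omega))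
  · have hD : (((lam + s - 1) / 2 : ℕ) : ℤ) = ((lam : ℤ) + s - 1) / 2 := by omega
    refine le_trans ?_ (edist_le_ediam (u := 0)
      (v := (((s : ℤ) / 2 + (((lam : ℤ) + s - 1) / 2 - s / 2) * s : ℤ) : ZMod n)))
    refine le_iInf fun p => Nat.cast_le.2 ?_
    obtain ⟨a, b, hab, hle⟩ := exists_zsmul_of_walk p
    have hab' : (((s : ℤ) / 2 + (((lam : ℤ) + s - 1) / 2 - s / 2) * s : ℤ) : ZMod n) =
        ((a + b * s : ℤ) : ZMod n) := by
      rw [← sub_zero (Int.cast _), hab]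
      simp
    rw [ZMod.intCast_eq_intCast_iff_dvd_sub, hlam] at hab'
    obtain ⟨m, hm⟩ := hab'
    push_cast at hm
    have hs0 : (s : ℤ) ≠ 0 := by omega
    have key := half_le_abs_add_abs (s := s) (l := lam) (by omega) (by omega)
      (((lam : ℤ) + s - 1) / 2 - s / 2 - b + m * lam) m
    have e₁ : (s : ℤ) / 2 + (((lam : ℤ) + s - 1) / 2 - s / 2 - b + m * lam) * s = a := by
      linear_combination -hm
    have e₂ : ((lam : ℤ) + s - 1) / 2 - s / 2 -
        (((lam : ℤ) + s - 1) / 2 - s / 2 - b + m * lam) + m * lam = b := by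
      ring
    rw [e₁, e₂] at key
    omega
end

section
/- Let n ≥ 5 and s be integers with 2 ≤ s ≤ ⌊(n−1)/2⌋, with n even, s odd, and λ > γ > 0. Then diam(C_n(1,s)) = ⌈λ/2⌉ + (s−1)/2 − (min(⌈γ/2⌉, ⌈(s−γ+1)/2⌉) − 1). -/
open SimpleGraph

/-- Vertices differing by `a + b * s` are at distance at most `|a| + |b|`. -/
lemma edist_circulantGraph_le {n : ℕ} (s : ZMod n) (u : ZMod n) (a b : ℤ) :
    (circulantGraph ({1, s} : Set (ZMod n))).edist u (u + a + b * s) ≤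
      ((a.natAbs + b.natAbs : ℕ) : ℕ∞) := by
  set G := circulantGraph ({1, s} : Set (ZMod n)) with hG
  have step : ∀ t ∈ ({1, s} : Set (ZMod n)), ∀ u, G.edist u (u + t) ≤ 1 := by
    intro t ht u
    rw [edist_le_one_iff_adj_or_eq]
    by_cases h : u = u + t
    · exact Or.inr h
    · left
      rw [hG, circulantGraph_adj]
      exact ⟨h, Or.inr (by simpa using ht)⟩
  have nsteps : ∀ t ∈ ({1, s} : Set (ZMod n)), ∀ (k : ℕ) u,
      G.edist u (u + k * t) ≤ (k : ℕ∞) := by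
    intro t ht k
    induction k with
    | zero => intro u; simp
    | succ k ih =>
      intro u
      calc G.edist u (u + (k + 1 : ℕ) * t)
          ≤ G.edist u (u + k * t) + G.edist (u + k * t) (u + (k + 1 : ℕ) * t) :=
            G.edist_triangle
        _ ≤ k + 1 := by
            refine add_le_add (ih u) ?_
            have e : u + (k + 1 : ℕ) * t = u + k * t + t := by push_cast; ring
            exact e ▸ step t ht (u + k * t)
        _ = ((k + 1 : ℕ) : ℕ∞) := by push_cast; rfl
  have zsteps : ∀ t ∈ ({1, s} : Set (ZMod n)), ∀ (k : ℤ) u,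
      G.edist u (u + k * t) ≤ (k.natAbs : ℕ∞) := by
    intro t ht k u
    obtain ⟨m, rfl | rfl⟩ := k.eq_nat_or_neg
    · simpa using nsteps t ht m u
    · have := nsteps t ht m (u + (-(m : ℤ) : ℤ) * t)
      rw [G.edist_comm] at this
      simpa using this
  calc G.edist u (u + a + b * s)
      ≤ G.edist u (u + a) + G.edist (u + a) (u + a + b * s) := G.edist_triangle
    _ ≤ a.natAbs + b.natAbs := by
        refine add_le_add ?_ (zsteps s (by simp) b _)
        simpa using zsteps 1 (by simp) a u
    _ = _ := by push_cast; rfl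

/-- A walk in `circulantGraph {1, s}` of length `ℓ` displaces its start by some `a + b * s` with
`|a| + |b| ≤ ℓ`. -/
lemma exists_displacement_of_walk {n : ℕ} (s : ZMod n) {u v : ZMod n}
    (p : (circulantGraph ({1, s} : Set (ZMod n))).Walk u v) :
    ∃ a b : ℤ, v = u + a + b * s ∧ |a| + |b| ≤ p.length := by
  induction p with
  | nil => exact ⟨0, 0, by simp, by simp⟩
  | @cons u v w h p ih =>
    obtain ⟨a, b, rfl, hab⟩ := ih
    rw [circulantGraph_adj] at h
    simp only [Set.mem_insert_iff, Set.mem_singleton_iff] at h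
    rw [Walk.length_cons]
    push_cast
    rcases h.2 with (h | h) | (h | h)
    · refine ⟨a - 1, b, ?_, by grind⟩
      push_cast; linear_combination -h
    · refine ⟨a, b - 1, ?_, by grind⟩
      push_cast; linear_combination -h
    · refine ⟨a + 1, b, ?_, by grind⟩
      push_cast; linear_combination h
    · refine ⟨a, b + 1, ?_, by grind⟩
      push_cast; linear_combination h

/-- In the lattice generated by `(s, -1)` and `(γ, λ)`, no point is closer in the `ℓ¹` norm than `D`
to the point `(x, y)` with `x + y = D` and `x - y = s + 1 - D`. -/
lemma le_abs_add_abs_of_deep_hole {s l g D x y i j : ℤ} (hs : 1 ≤ s) (hg : 0 ≤ g) (hgl : g ≤ l)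
    (hu : x + y = D) (hv : x - y = s + 1 - D) (h₁ : 2 * D ≤ s - 1 + g + l)
    (h₂ : 2 * D ≤ 2 * (s + 1) + l - g) (h₃ : 2 * D ≤ l - g + s + 1 ∨ 2 * D ≤ l + g) :
    D ≤ |x - i * s - j * g| + |y + i - j * l| := by
  suffices D ≤ D - i * (s - 1) - j * (g + l) ∨ D - i * (s - 1) - j * (g + l) ≤ -D ∨
      D ≤ s + 1 - D - i * (s + 1) + j * (l - g) ∨
      s + 1 - D - i * (s + 1) + j * (l - g) ≤ -D by
    have e₁ : (x - i * s - j * g) + (y + i - j * l) = D - i * (s - 1) - j * (g + l) := by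
      linear_combination hu
    have e₂ : (x - i * s - j * g) - (y + i - j * l) =
        s + 1 - D - i * (s + 1) + j * (l - g) := by
      linear_combination hv
    rw [← e₁, ← e₂] at this
    grind
  rcases le_or_gt i 0 with hi | hi <;> rcases le_or_gt j 0 with hj | hj
  · left
    nlinarith
  · rcases h₃ with h₃ | h₃
    · right; right; left
      nlinarith
    · rcases hi.eq_or_lt with rfl | hi
      · right; left
        nlinarith
      · right; right; left
        nlinarith
  · right; right; right
    nlinarith
  · right; left
    nlinarith

/-- `n` even, `s` odd, `λ > γ > 0`:
`diam(C_n(1,s)) = ⌈λ/2⌉ + (s-1)/2 - (min(⌈γ/2⌉, ⌈(s-γ+1)/2⌉) - 1)`. -/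
theorem diam_circulant_even_odd (n s lam gam : ℕ) (hn : 5 ≤ n) (hs2 : 2 ≤ s)
    (hs : s ≤ (n - 1) / 2) (hne : Even n) (hso : Odd s)
    (hlam : lam = n / s) (hgam : gam = n % s) (hgam0 : 0 < gam) (hlg : gam < lam) :
    (circulantGraph ({1, (s : ZMod n)} : Set (ZMod n))).diam =
      (lam + 1) / 2 + (s - 1) / 2 - (min ((gam + 1) / 2) ((s - gam + 2) / 2) - 1) := by
  have hdiv : s * lam + gam = n := by rw [hlam, hgam]; exact Nat.div_add_mod n s
  have hgs : gam < s := hgam ▸ Nat.mod_lt n (by omega)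
  have hpar : (lam + gam) % 2 = 0 := by
    have h₁ : (s * lam + gam) % 2 = 0 := by rw [hdiv]; exact Nat.even_iff.mp hne
    have h₂ := Nat.odd_iff.mp hso
    rw [Nat.add_mod, Nat.mul_mod, h₂] at h₁
    omega
  have hsodd := Nat.odd_iff.mp hso
  set D := (lam + 1) / 2 + (s - 1) / 2 - (min ((gam + 1) / 2) ((s - gam + 2) / 2) - 1) with hD
  set G := circulantGraph ({1, (s : ZMod n)} : Set (ZMod n))
  have : NeZero n := ⟨by omega⟩
  have hn0 : (s : ZMod n) * lam + gam = 0 := by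
    have : ((s * lam + gam : ℕ) : ZMod n) = 0 := by rw [hdiv]; exact ZMod.natCast_self n
    exact_mod_cast this
  have upper : G.ediam ≤ D := by
    refine ediam_le_of_edist_le fun u v ↦ ?_
    suffices ∃ a b : ℤ, v = u + a + b * s ∧ a.natAbs + b.natAbs ≤ D by
      obtain ⟨a, b, rfl, hab⟩ := this
      exact (edist_circulantGraph_le _ u a b).trans (by exact_mod_cast hab)
    set k := (v - u).val
    have hkn : k < n := ZMod.val_lt _
    have hkv : (k : ZMod n) = v - u := ZMod.natCast_zmod_val _
    have hkdiv := Nat.div_add_mod k s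
    have hr : k % s < s := Nat.mod_lt k (by omega)
    have hq : k / s ≤ lam := hlam ▸ Nat.div_le_div_right hkn.le
    generalize k / s = q at *
    generalize k % s = r at *
    have hv : v = u + r + q * s := by
      have : ((s * q + r : ℕ) : ZMod n) = v - u := by rw [hkdiv, hkv]
      push_cast at this
      linear_combination -this
    have key : r + q ≤ D ∨ s - r + q + 1 ≤ D ∨
        ((r : ℤ) - gam).natAbs + ((q : ℤ) - lam).natAbs ≤ D := by
      omega
    rcases key with h | h | h
    · exact ⟨r, q, by push_cast; exact hv, by omega⟩
    · exact ⟨r - s, q + 1, by push_cast; linear_combination hv, by omega⟩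
    · exact ⟨r - gam, q - lam, by push_cast; linear_combination hv + hn0, h⟩
  refine le_antisymm (ENat.toNat_le_of_le_natCast upper) ?_
  have htop : G.ediam ≠ ⊤ := ne_top_of_le_ne_top (ENat.natCast_ne_top D) upper
  set x : ℤ := (s + 1) / 2 with hx
  set y : ℤ := D - x with hy
  refine le_trans ?_ (dist_le_diam htop (u := 0) (v := (x + y * s : ZMod n)))
  obtain ⟨p, hp⟩ := (connected_of_ediam_ne_top htop).exists_walk_length_eq_dist 0
    (x + y * s : ZMod n)
  rw [← hp]
  obtain ⟨a, b, hab, hlen⟩ := exists_displacement_of_walk _ p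
  have hcong : ((a - x + (b - y) * s : ℤ) : ZMod n) = 0 := by
    push_cast; linear_combination -hab
  obtain ⟨t, ht⟩ := (ZMod.intCast_zmod_eq_zero_iff_dvd _ n).mp hcong
  have hdivZ : (n : ℤ) = s * lam + gam := by exact_mod_cast hdiv.symm
  have hole := le_abs_add_abs_of_deep_hole (s := s) (l := lam) (g := gam) (D := D) (x := x) (y := y)
    (i := b - y - t * lam) (j := -t) (by omega) (by omega) (by omega) (by omega) (by omega)
    (by omega) (by omega) (by omega)
  have ha : x - (b - y - t * lam) * s - -t * gam = a := by
    rw [hdivZ] at ht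
    linear_combination -ht
  have hb : y + (b - y - t * lam) - -t * lam = b := by ring
  rw [ha, hb] at hole
  exact_mod_cast hole.trans hlen
end

section
/- Let n ≥ 5 and s be integers with 2 ≤ s ≤ ⌊(n−1)/2⌋, with n even, s odd, and λ > γ > 0. Then diam(C_n(1,s)) ≤ ⌈λ/2⌉ + (s−1)/2 − (min(⌈γ/2⌉, ⌈(s−γ+1)/2⌉) − 1). -/
open SimpleGraph

namespace SimpleGraph

lemma edist_add_le_one_of_mem {G : Type*} [AddCommGroup G] {S : Set G} {g : G} (hg : g ∈ S)
    (x : G) : (circulantGraph S).edist x (x + g) ≤ 1 := by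
  by_cases h : x = x + g
  · rw [← h, edist_self]
    exact zero_le_one
  · refine le_of_eq (edist_eq_one_iff_adj.2 ?_)
    simp only [circulantGraph, fromRel_adj]
    exact ⟨h, Or.inr (by simpa using hg)⟩

lemma edist_add_nsmul_le {G : Type*} [AddCommGroup G] {S : Set G} {g : G} (hg : g ∈ S)
    (x : G) (k : ℕ) : (circulantGraph S).edist x (x + k • g) ≤ k := by
  induction k with
  | zero => simp
  | succ k ih =>
    rw [succ_nsmul, ← add_assoc, Nat.cast_succ]
    exact (SimpleGraph.edist_triangle (v := x + k • g)).trans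
      (add_le_add ih (edist_add_le_one_of_mem hg _))

lemma edist_add_zsmul_le {G : Type*} [AddCommGroup G] {S : Set G} {g : G} (hg : g ∈ S)
    (x : G) (a : ℤ) : (circulantGraph S).edist x (x + a • g) ≤ a.natAbs := by
  obtain ⟨k, rfl | rfl⟩ := a.eq_nat_or_neg
  · simpa using edist_add_nsmul_le hg x k
  · rw [edist_comm]
    simpa using edist_add_nsmul_le hg (x + (-(k : ℤ)) • g) k

/-- If `y - x = a • g + b • h` for two generators `g`, `h` of a circulant graph, then `x` and `y`
are at distance at most `|a| + |b|`. -/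
lemma edist_le_of_sub_eq {G : Type*} [AddCommGroup G] {S : Set G} {g h : G} (hg : g ∈ S)
    (hh : h ∈ S) {x y : G} (a b : ℤ) (hxy : y - x = a • g + b • h) :
    (circulantGraph S).edist x y ≤ (a.natAbs + b.natAbs : ℕ) := by
  obtain rfl : y = x + a • g + b • h := by rw [add_assoc, ← hxy]; abel
  rw [Nat.cast_add]
  exact (SimpleGraph.edist_triangle (v := x + a • g)).trans
    (add_le_add (edist_add_zsmul_le hg _ _) (edist_add_zsmul_le hh _ _))

end SimpleGraph

/-- Every residue `q * s + t` in the first half of `ℤ/nℤ`, `n = lam * s + gam`, is reached by one of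
the three moves `(t, q)`, `(t - s, q + 1)`, `(t - gam, q - lam)` within the claimed bound. -/
lemma circulant_even_odd_short_representation (s lam gam q t : ℕ) (hso : s % 2 = 1)
    (hpar : lam % 2 = gam % 2) (hgam0 : 0 < gam) (hlg : gam < lam) (hgs : gam < s) (ht : t < s)
    (hq : 2 * q ≤ lam) (hq0 : 2 * q = lam → 2 * t ≤ gam)
    (hq1 : 2 * q + 1 = lam → 2 * t ≤ s + gam) :
    ∃ a b : ℤ, ((a = t ∧ b = q) ∨ (a = t - s ∧ b = q + 1) ∨ (a = t - gam ∧ b = q - lam)) ∧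
      a.natAbs + b.natAbs ≤
        (lam + 1) / 2 + (s - 1) / 2 - (min ((gam + 1) / 2) ((s - gam + 2) / 2) - 1) := by
  by_contra! H
  have h1 := H _ _ (Or.inl ⟨rfl, rfl⟩)
  have h2 := H _ _ (Or.inr (Or.inl ⟨rfl, rfl⟩))
  have h3 := H _ _ (Or.inr (Or.inr ⟨rfl, rfl⟩))
  clear H
  omega

/-- `n` even, `s` odd, `λ > γ > 0`:
`diam(C_n(1,s)) ≤ ⌈λ/2⌉ + (s-1)/2 - (min(⌈γ/2⌉, ⌈(s-γ+1)/2⌉) - 1)`. -/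
theorem diam_circulant_even_odd_le (n s lam gam : ℕ) (hn : 5 ≤ n) (hs2 : 2 ≤ s)
    (hs : s ≤ (n - 1) / 2) (hne : Even n) (hso : Odd s)
    (hlam : lam = n / s) (hgam : gam = n % s) (hgam0 : 0 < gam) (hlg : gam < lam) :
    (circulantGraph ({1, (s : ZMod n)} : Set (ZMod n))).diam ≤
      (lam + 1) / 2 + (s - 1) / 2 - (min ((gam + 1) / 2) ((s - gam + 2) / 2) - 1) := by
  have hdecomp : s * lam + gam = n := by rw [hlam, hgam]; exact Nat.div_add_mod n s
  have hgs : gam < s := hgam ▸ Nat.mod_lt _ (by omega)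
  have hpar : lam % 2 = gam % 2 := by
    have h : Even (s * lam + gam) := hdecomp ▸ hne
    have hs' : ¬ Even s := Nat.not_even_iff_odd.2 hso
    rw [Nat.even_add, Nat.even_mul] at h
    simp only [hs', false_or, Nat.even_iff] at h
    omega
  have hnz : NeZero n := ⟨by omega⟩
  set B := (lam + 1) / 2 + (s - 1) / 2 - (min ((gam + 1) / 2) ((s - gam + 2) / 2) - 1)
  have half : ∀ x y : ZMod n, 2 * (y - x).val ≤ n →
      (circulantGraph ({1, (s : ZMod n)} : Set (ZMod n))).edist x y ≤ B := by
    intro x y hr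
    obtain ⟨q, t, hqt, ht⟩ : ∃ q t, s * q + t = (y - x).val ∧ t < s :=
      ⟨_, _, Nat.div_add_mod _ s, Nat.mod_lt _ (by omega)⟩
    have hle : 2 * (s * q + t) ≤ s * lam + gam := by rw [hqt, hdecomp]; exact hr
    have hq : 2 * q ≤ lam := by
      by_contra! h
      nlinarith [Nat.mul_le_mul_left s (Nat.succ_le_of_lt h)]
    obtain ⟨a, b, hab, hbd⟩ := circulant_even_odd_short_representation s lam gam q t
      (Nat.odd_iff.1 hso) hpar hgam0 hlg hgs ht hq (fun h => by subst h; nlinarith)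
      (fun h => by subst h; nlinarith)
    have hyx : y - x = (s : ZMod n) * q + t := by
      rw [← ZMod.natCast_zmod_val (y - x), ← hqt]; push_cast; ring
    have hn0 : (s : ZMod n) * lam + gam = 0 := by
      have := ZMod.natCast_self n
      rw [← hdecomp] at this ⊢
      exact_mod_cast this
    refine (edist_le_of_sub_eq (g := 1) (h := (s : ZMod n)) (by simp) (by simp) a b ?_).trans
      (Nat.cast_le.2 hbd)
    rw [hyx]
    rcases hab with ⟨rfl, rfl⟩ | ⟨rfl, rfl⟩ | ⟨rfl, rfl⟩ <;> simp only [zsmul_eq_mul] <;>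
      push_cast
    · ring
    · ring
    · linear_combination hn0
  have hed : (circulantGraph ({1, (s : ZMod n)} : Set (ZMod n))).ediam ≤ B := by
    refine ediam_le_of_edist_le fun x y => ?_
    rcases le_total (2 * (y - x).val) n with h | h
    · exact half x y h
    · rw [edist_comm]
      refine half y x ?_
      rw [← neg_sub, ZMod.neg_val]
      split_ifs <;> omega
  exact ENat.toNat_le_of_le_natCast hed
end

section
/- Let n ≥ 5 and s be integers with 2 ≤ s ≤ ⌊(n−1)/2⌋, with n even, s odd, and λ > γ > 0. Then there exists a vertex i of C_n(1,s) such that d(0,i) = ⌈λ/2⌉ + (s−1)/2 − (min(⌈γ/2⌉, ⌈(s−γ+1)/2⌉) − 1). -/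
open SimpleGraph

theorem SimpleGraph.exists_dist_eq_of_le_dist {V : Type*} {G : SimpleGraph V} {u v : V} {d : ℕ}
    (h : d ≤ G.dist u v) : ∃ w, G.dist u w = d := by
  rcases Nat.eq_zero_or_pos d with rfl | hd
  · exact ⟨u, dist_self⟩
  obtain ⟨p, hp⟩ := exists_walk_of_dist_ne_zero (G := G) (u := u) (v := v) (by omega)
  refine ⟨p.getVert d, ?_⟩
  rw [← length_eq_dist_of_subwalk hp (p.isSubwalk_take d), Walk.take_length]
  omega

/-- A walk in `C_n(1,s)` splits as `x` unit steps and `y` steps of size `s`, counted with signs. -/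
theorem exists_abs_add_abs_le_of_walk {n s : ℕ} {u v : ZMod n}
    (p : (circulantGraph ({1, (s : ZMod n)} : Set (ZMod n))).Walk u v) :
    ∃ x y : ℤ, v = u + x + y * s ∧ |x| + |y| ≤ p.length := by
  induction p with
  | nil => exact ⟨0, 0, by simp, by simp⟩
  | @cons a b c hab q ih =>
    obtain ⟨x, y, hc, hxy⟩ := ih
    have key : ∀ e f : ℤ, b - a = e + f * s → |e| + |f| ≤ 1 →
        ∃ x y : ℤ, c = a + x + y * s ∧ |x| + |y| ≤ (Walk.cons hab q).length := by
      intro e f hb hef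
      refine ⟨x + e, y + f, ?_, ?_⟩
      · rw [hc]
        push_cast
        linear_combination hb
      · have h₁ := abs_add_le x e
        have h₂ := abs_add_le y f
        simp only [Walk.length_cons, Nat.cast_add, Nat.cast_one]
        linarith
    simp only [circulantGraph_adj, Set.mem_insert_iff, Set.mem_singleton_iff] at hab
    rcases hab.2 with (h | h) | (h | h)
    · exact key (-1) 0 (by push_cast; linear_combination -h) (by simp)
    · exact key 0 (-1) (by push_cast; linear_combination -h) (by simp)
    · exact key 1 0 (by push_cast; linear_combination h) (by simp)
    · exact key 0 1 (by push_cast; linear_combination h) (by simp)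

theorem reachable_zero_circulantGraph {n : ℕ} [NeZero n] (s : ℕ) (i : ZMod n) :
    (circulantGraph ({1, (s : ZMod n)} : Set (ZMod n))).Reachable 0 i := by
  obtain ⟨m, rfl⟩ := ZMod.natCast_zmod_surjective i
  induction m with
  | zero => simp
  | succ m ih =>
    refine ih.trans ?_
    by_cases h : (m : ZMod n) = ((m + 1 : ℕ) : ZMod n)
    · rw [← h]
    · apply Adj.reachable
      simp only [circulantGraph_adj]
      exact ⟨h, Or.inr (by simp)⟩

theorem le_dist_circulantGraph {n s l g : ℕ} (hn : 0 < n) (hnsl : n = l * s + g)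
    {x₀ y₀ : ℤ} {d : ℕ}
    (h : ∀ t k : ℤ, (d : ℤ) ≤ |x₀ + t * g + k * s| + |y₀ + t * l - k|) :
    d ≤ (circulantGraph ({1, (s : ZMod n)} : Set (ZMod n))).dist 0 (x₀ + y₀ * s) := by
  have : NeZero n := ⟨hn.ne'⟩
  obtain ⟨p, hp⟩ :=
    (reachable_zero_circulantGraph s (x₀ + y₀ * s : ZMod n)).exists_walk_length_eq_dist
  obtain ⟨x, y, hxy, hle⟩ := exists_abs_add_abs_le_of_walk p
  have hdvd : (n : ℤ) ∣ (x + y * s) - (x₀ + y₀ * s) := by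
    rw [← ZMod.intCast_zmod_eq_zero_iff_dvd]
    push_cast
    linear_combination -hxy
  obtain ⟨t, ht⟩ := hdvd
  have hnZ : (n : ℤ) = l * s + g := by exact_mod_cast hnsl
  rw [hnZ] at ht
  have hd := h t (y₀ + t * l - y)
  have hx : x₀ + t * g + (y₀ + t * l - y) * s = x := by linear_combination -ht
  have hy : y₀ + t * l - (y₀ + t * l - y) = y := by ring
  rw [hx, hy] at hd
  rw [← hp]
  exact_mod_cast hd.trans hle

/-- The midpoint of `(g, l)` is far from the lattice spanned by `(s, -1)` and `(g, l)`. -/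
theorem le_abs_add_abs_midpoint {s l g d x y : ℤ} (hg : 0 < g) (hgs : g < s) (hgl : g < l)
    (hd : 2 * d = l + g) (hxy : x + y = d) (hx : g ≤ 2 * x) (hx' : 2 * x ≤ g + 1) (t k : ℤ) :
    d ≤ |x + t * g + k * s| + |y + t * l - k| := by
  by_contra! hlt
  generalize hX : x + t * g + k * s = X at hlt
  generalize hY : y + t * l - k = Y at hlt
  have h₁ := le_abs_self X
  have h₂ := neg_abs_le X
  have h₃ := le_abs_self Y
  have h₄ := neg_abs_le Y
  have hu : X + Y = d + t * (l + g) + k * (s - 1) := by rw [← hX, ← hY, ← hxy]; ring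
  have hv : X - Y = x - y + t * (g - l) + k * (s + 1) := by rw [← hX, ← hY]; ring
  rcases lt_trichotomy k 0 with hk | rfl | hk
  · have ht : 0 ≤ t := by
      by_contra! ht
      nlinarith
    nlinarith
  · have : -1 < t := by
      by_contra! ht
      nlinarith
    nlinarith
  · have ht : t ≤ -1 := by
      by_contra! ht
      nlinarith
    nlinarith

/-- The midpoint of `(g - s, l + 1)` is far from the lattice spanned by `(s, -1)` and `(g, l)`. -/
theorem le_abs_add_abs_midpoint' {s l g d x y : ℤ} (hg : 0 < g) (hgs : g < s) (hgl : g < l)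
    (hd : 2 * d = l + 1 + s - g) (hxy : y - x = d) (hx : g - s ≤ 2 * x)
    (hx' : 2 * x ≤ g - s ∨ 2 ≤ g ∧ 2 * x ≤ g - s + 1) (t k : ℤ) :
    d ≤ |x + t * g + k * s| + |y + t * l - k| := by
  by_contra! hlt
  generalize hX : x + t * g + k * s = X at hlt
  generalize hY : y + t * l - k = Y at hlt
  have h₁ := le_abs_self X
  have h₂ := neg_abs_le X
  have h₃ := le_abs_self Y
  have h₄ := neg_abs_le Y
  obtain ⟨m, rfl⟩ : ∃ m, k = m - t := ⟨k + t, by ring⟩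
  have hv : Y - X = d + t * (2 * d) - m * (s + 1) := by rw [← hX, ← hY, hd, ← hxy]; ring
  have hu : X + Y = x + y + (m - t) * (s - 1) + t * (l + g) := by rw [← hX, ← hY]; ring
  rcases lt_trichotomy m 0 with hm | rfl | hm
  · have ht : t ≤ -1 := by
      by_contra! ht
      nlinarith
    have htm : m ≤ t := by
      by_contra! htm
      nlinarith
    have h₅ : (m - t) * (s - 1) ≤ 0 := by nlinarith
    have h₆ : t * (l + g) ≤ -(l + g) := by nlinarith
    omega
  · have : -1 < t := by
      by_contra! ht
      nlinarith
    nlinarith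
  · have ht : 0 ≤ t := by
      by_contra! ht
      nlinarith
    have htm : t ≤ m - 1 := by
      by_contra! htm
      nlinarith
    have h₅ : s - 1 ≤ (m - t) * (s - 1) := by nlinarith
    have h₆ : 0 ≤ t * (l + g) := by nlinarith
    omega

/-- `n` even, `s` odd, `λ > γ > 0`: there exists a vertex `i` with
`d(0,i) = ⌈λ/2⌉ + (s-1)/2 - (min(⌈γ/2⌉, ⌈(s-γ+1)/2⌉) - 1)`. -/
theorem exists_vertex_dist_even_odd (n s lam gam : ℕ) (hn : 5 ≤ n) (hs2 : 2 ≤ s)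
    (hs : s ≤ (n - 1) / 2) (hne : Even n) (hso : Odd s)
    (hlam : lam = n / s) (hgam : gam = n % s) (hgam0 : 0 < gam) (hlg : gam < lam) :
    ∃ i : ZMod n, (circulantGraph ({1, (s : ZMod n)} : Set (ZMod n))).dist 0 i =
      (lam + 1) / 2 + (s - 1) / 2 - (min ((gam + 1) / 2) ((s - gam + 2) / 2) - 1) := by
  have hgs : gam < s := hgam ▸ Nat.mod_lt _ (by omega)
  have hnsl : n = lam * s + gam := by rw [hlam, hgam, Nat.div_add_mod']
  have hpar : Even (lam + gam) := by
    rw [hnsl] at hne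
    have := Nat.not_even_iff_odd.mpr hso
    simp only [Nat.even_add, Nat.even_mul] at hne ⊢
    tauto
  rw [Nat.even_iff] at hpar
  rw [Nat.odd_iff] at hso
  by_cases hcase : s + 1 ≤ 2 * gam
  · have hD : (lam + 1) / 2 + (s - 1) / 2 - (min ((gam + 1) / 2) ((s - gam + 2) / 2) - 1) =
        (lam + gam) / 2 := by omega
    rw [hD]
    exact exists_dist_eq_of_le_dist <| le_dist_circulantGraph (by omega) hnsl <|
      le_abs_add_abs_midpoint (x := ((gam : ℤ) + 1) / 2) (y := (lam : ℤ) / 2)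
        (by omega) (by omega) (by omega) (by omega) (by omega) (by omega) (by omega)
  · have hD : (lam + 1) / 2 + (s - 1) / 2 - (min ((gam + 1) / 2) ((s - gam + 2) / 2) - 1) =
        (lam + 1 + s - gam) / 2 := by omega
    rw [hD]
    exact exists_dist_eq_of_le_dist <| le_dist_circulantGraph (by omega) hnsl <|
      le_abs_add_abs_midpoint' (x := ((gam : ℤ) - s + 1) / 2) (y := (lam : ℤ) / 2 + 1)
        (by omega) (by omega) (by omega) (by omega) (by omega) (by omega) (by omega)
end

section
/- Let n ≥ 5 and s be integers with 2 ≤ s ≤ ⌊(n−1)/2⌋, with n even, s even, and λ > γ > 0. Then diam(C_n(1,s)) ≤ ⌈λ/2⌉ + (s−γ)/2 if γ ≤ 2⌈(s−2)/4⌉, and diam(C_n(1,s)) ≤ ⌊λ/2⌋ + γ/2 otherwise. -/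
open SimpleGraph

/-- In a circulant graph, moving `k` times along a jump `g` costs at most `|k|`. -/
theorem edist_circulantGraph_add_zsmul_le {G : Type*} [AddCommGroup G] {S : Set G} {g : G}
    (hg : g ∈ S) (u : G) (k : ℤ) :
    (circulantGraph S).edist u (u + k • g) ≤ (k.natAbs : ℕ∞) := by
  have step (v : G) : (circulantGraph S).edist v (v + g) ≤ 1 := by
    rw [edist_le_one_iff_adj_or_eq]
    by_cases h : v = v + g
    · exact Or.inr h
    · exact Or.inl (by simp [circulantGraph, h, hg])
  have key (m : ℕ) (v : G) : (circulantGraph S).edist v (v + m • g) ≤ (m : ℕ∞) := by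
    induction m with
    | zero => simp
    | succ m ih =>
      refine SimpleGraph.edist_triangle (v := v + m • g) |>.trans ?_
      rw [succ_nsmul, ← add_assoc, Nat.cast_succ]
      exact add_le_add ih (step _)
  obtain ⟨m, rfl | rfl⟩ := k.eq_nat_or_neg
  · simpa using key m u
  · rw [SimpleGraph.edist_comm]
    simpa [sub_eq_add_neg] using key m (u - m • g)

/-- The distance between `u` and `u + a + b * s` in `C_n(1, s)` is at most `|a| + |b|`. -/
theorem edist_circulantGraph_one_le {n s : ℕ} (u v : ZMod n) (a b : ℤ)
    (h : v - u = a + b * s) :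
    (circulantGraph ({1, (s : ZMod n)} : Set (ZMod n))).edist u v ≤
      ((a.natAbs + b.natAbs : ℕ) : ℕ∞) := by
  obtain rfl : v = u + a • (1 : ZMod n) + b • (s : ZMod n) := by
    rw [← sub_add_cancel v u, h]
    simp only [zsmul_eq_mul]
    ring
  refine SimpleGraph.edist_triangle (v := u + a • (1 : ZMod n)) |>.trans ?_
  rw [Nat.cast_add]
  exact add_le_add (edist_circulantGraph_add_zsmul_le (by simp) u a)
    (edist_circulantGraph_add_zsmul_le (by simp) _ b)

/-- One of five representations of the residue `q * s + r` modulo `lam * s + gam` is short. -/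
theorem exists_short_representation (s lam gam q r D : ℕ) (hse : Even s) (hge : Even gam)
    (hr : r < s) (hq : q ≤ lam) (hqr : q = lam → r < gam) (hgam0 : 0 < gam) (hgs : gam < s)
    (hlg : gam < lam)
    (hD : D = if gam ≤ 2 * ((s - 2 + 3) / 4) then (lam + 1) / 2 + (s - gam) / 2
      else lam / 2 + gam / 2) :
    ∃ i j : ℤ, ((r : ℤ) - i * s - j * gam).natAbs + ((q : ℤ) + i - j * lam).natAbs ≤ D := by
  obtain ⟨s, rfl⟩ := hse
  obtain ⟨gam, rfl⟩ := hge
  by_contra! h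
  have h1 := h 0 0
  have h2 := h 1 0
  have h3 := h 0 1
  have h4 := h 1 1
  have h5 := h (-1) 1
  clear h
  push_cast at *
  split_ifs at hD <;> omega




/-- `n` even, `s` even, `λ > γ > 0`:
`diam(C_n(1,s)) ≤ ⌈λ/2⌉ + (s-γ)/2` if `γ ≤ 2⌈(s-2)/4⌉`, and `≤ ⌊λ/2⌋ + γ/2` otherwise. -/
theorem diam_circulant_even_even_le (n s lam gam : ℕ) (hn : 5 ≤ n) (hs2 : 2 ≤ s)
    (hs : s ≤ (n - 1) / 2) (hne : Even n) (hse : Even s)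
    (hlam : lam = n / s) (hgam : gam = n % s) (hgam0 : 0 < gam) (hlg : gam < lam) :
    (circulantGraph ({1, (s : ZMod n)} : Set (ZMod n))).diam ≤
      if gam ≤ 2 * ((s - 2 + 3) / 4) then (lam + 1) / 2 + (s - gam) / 2
      else lam / 2 + gam / 2 := by
  have hs0 : 0 < s := by omega
  have hgs : gam < s := hgam ▸ Nat.mod_lt _ hs0
  have hn' : lam * s + gam = n := by
    rw [hlam, hgam, mul_comm]
    exact Nat.div_add_mod n s
  have hge : Even gam := by
    rw [hgam]
    exact (hne.mod_even hse)
  have : NeZero n := ⟨by omega⟩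
  refine ENat.toNat_le_of_le_natCast (ediam_le_of_edist_le fun u v ↦ ?_)
  have hx : (v - u).val < n := ZMod.val_lt _
  have hqr := Nat.div_add_mod (v - u).val s
  have hr : (v - u).val % s < s := Nat.mod_lt _ hs0
  have hq : (v - u).val / s ≤ lam := hlam ▸ Nat.div_le_div_right hx.le
  have hlast : (v - u).val / s = lam → (v - u).val % s < gam := by
    intro h
    rw [h, mul_comm] at hqr
    omega
  obtain ⟨i, j, hij⟩ := exists_short_representation s lam gam _ _ _ hse hge hr hq hlast hgam0 hgs
    hlg rfl
  refine (edist_circulantGraph_one_le u v _ _ ?_).trans (Nat.cast_le.2 hij)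
  have hv : v - u = (s : ZMod n) * ((v - u).val / s : ℕ) + ((v - u).val % s : ℕ) := by
    rw [← Nat.cast_mul, ← Nat.cast_add, hqr, ZMod.natCast_zmod_val]
  have hz : (lam : ZMod n) * s + gam = 0 := by
    rw [← Nat.cast_mul, ← Nat.cast_add, hn', ZMod.natCast_self]
  generalize (v - u).val / s = q, (v - u).val % s = r at hv ⊢
  push_cast
  linear_combination hv + (j : ZMod n) * hz
end

section
/- Let n ≥ 5 and s be integers with 2 ≤ s ≤ ⌊(n−1)/2⌋, with n even, s even, and λ > γ > 0. Then there exists a vertex i of C_n(1,s) such that d(0,i) = ⌈λ/2⌉ + (s−γ)/2 if γ ≤ 2⌈(s−2)/4⌉, and such that d(0,i) = ⌊λ/2⌋ + γ/2 otherwise. -/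
open SimpleGraph

/-- In a circulant graph, translating by a generator `k` times is realised by a walk of length
`k`. -/
theorem exists_walk_add_nsmul {n : ℕ} {S : Set (ZMod n)} {g : ZMod n} (hg0 : g ≠ 0)
    (hg : g ∈ S ∨ -g ∈ S) (v : ZMod n) (k : ℕ) :
    ∃ p : (circulantGraph S).Walk v (v + k * g), p.length = k := by
  induction k with
  | zero => exact ⟨Walk.nil.copy rfl (by simp), by simp⟩
  | succ k ih =>
    obtain ⟨p, hp⟩ := ih
    have hadj : (circulantGraph S).Adj (v + k * g) (v + (k + 1 : ℕ) * g) := by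
      have h : v + ((k + 1 : ℕ) : ZMod n) * g = v + k * g + g := by push_cast; ring
      rw [h]
      simp only [circulantGraph, fromRel_adj]
      refine ⟨fun h' => hg0 (by simpa using h'), ?_⟩
      rcases hg with hg | hg
      · right; simpa using hg
      · left; simpa using hg
    exact ⟨p.concat hadj, by simp [hp]⟩

/-- The same for an integer multiple of a generator. -/
theorem exists_walk_add_zsmul {n : ℕ} {S : Set (ZMod n)} {g : ZMod n} (hg0 : g ≠ 0)
    (hg : g ∈ S) (v : ZMod n) (k : ℤ) :
    ∃ p : (circulantGraph S).Walk v (v + k * g), p.length = k.natAbs := by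
  obtain ⟨m, rfl | rfl⟩ := k.eq_nat_or_neg
  · obtain ⟨p, hp⟩ := exists_walk_add_nsmul hg0 (Or.inl hg) v m
    exact ⟨p.copy rfl (by simp), by simpa using hp⟩
  · obtain ⟨p, hp⟩ := exists_walk_add_nsmul (S := S) (neg_ne_zero.mpr hg0)
      (Or.inr (by simpa using hg)) v m
    exact ⟨p.copy rfl (by simp), by simpa using hp⟩

/-- The endpoint of a walk in `C_n(1,s)` is a combination of `1` and `s` whose coefficients are
bounded by the length of the walk. -/
theorem exists_coeffs_of_walk {n s : ℕ} {u v : ZMod n}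
    (p : (circulantGraph ({1, (s : ZMod n)} : Set (ZMod n))).Walk u v) :
    ∃ a b : ℤ, v = u + a + b * s ∧ |a| + |b| ≤ p.length := by
  induction p with
  | nil => exact ⟨0, 0, by simp, by simp⟩
  | @cons u w v h p ih =>
    obtain ⟨a, b, hv, hab⟩ := ih
    simp only [circulantGraph, fromRel_adj, Set.mem_insert_iff, Set.mem_singleton_iff] at h
    rw [Walk.length_cons]
    push_cast
    rcases h.2 with (h | h) | (h | h)
    · exact ⟨a - 1, b, by rw [hv, ← sub_eq_zero]; push_cast; linear_combination -h,
        by have := abs_sub a 1; rw [abs_one] at this; linarith⟩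
    · exact ⟨a, b - 1, by rw [hv, ← sub_eq_zero]; push_cast; linear_combination -h,
        by have := abs_sub b 1; rw [abs_one] at this; linarith⟩
    · exact ⟨a + 1, b, by rw [hv, ← sub_eq_zero]; push_cast; linear_combination h,
        by have := abs_add_le a 1; rw [abs_one] at this; linarith⟩
    · exact ⟨a, b + 1, by rw [hv, ← sub_eq_zero]; push_cast; linear_combination h,
        by have := abs_add_le b 1; rw [abs_one] at this; linarith⟩

/-- If `(a, b)` has minimal `ℓ¹`-norm modulo the lattice spanned by `(s, -1)` and `(γ, λ)`, then
the vertex `a + b s` is at distance `|a| + |b|` from `0` in `C_n(1,s)`. -/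
theorem dist_zero_eq_of_minimal {n s lam gam : ℕ} (hs0 : 0 < s) (hsn : s < n) (hn1 : 1 < n)
    (hn : n = lam * s + gam) (a b : ℤ)
    (hmin : ∀ x y : ℤ, |a| + |b| ≤ |a + x * s + y * gam| + |b - x + y * lam|) :
    (circulantGraph ({1, (s : ZMod n)} : Set (ZMod n))).dist 0 (a + b * s) =
      a.natAbs + b.natAbs := by
  have : Fact (1 < n) := ⟨hn1⟩
  have hs : (s : ZMod n) ≠ 0 := by
    rw [Ne, ZMod.natCast_eq_zero_iff]
    exact fun h => absurd (Nat.le_of_dvd hs0 h) (by omega)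
  obtain ⟨p, hp⟩ := exists_walk_add_zsmul (S := {1, (s : ZMod n)}) one_ne_zero (by simp) 0 a
  obtain ⟨q, hq⟩ := exists_walk_add_zsmul (S := {1, (s : ZMod n)}) hs (by simp)
    (0 + a * 1) b
  let w := (p.append q).copy rfl
    (show (0 : ZMod n) + a * 1 + b * s = a + b * s by ring)
  have hw : w.length = a.natAbs + b.natAbs := by simp [w, hp, hq]
  refine le_antisymm (hw ▸ dist_le w) ?_
  obtain ⟨r, hr⟩ := Reachable.exists_walk_length_eq_dist ⟨w⟩
  obtain ⟨a', b', hv, hab⟩ := exists_coeffs_of_walk r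
  have hdvd : (n : ℤ) ∣ a' + b' * s - (a + b * s) := by
    rw [← ZMod.intCast_eq_intCast_iff_dvd_sub]
    push_cast
    rw [hv]; ring
  obtain ⟨k, hk⟩ := hdvd
  have hnz : (n : ℤ) = lam * s + gam := by exact_mod_cast hn
  have h := hmin (k * lam - (b' - b)) k
  rw [show a + (k * lam - (b' - b)) * s + k * gam = a' by rw [hnz] at hk; linarith,
    show b - (k * lam - (b' - b)) + k * lam = b' by ring] at h
  rw [hr] at hab
  simp only [Int.abs_eq_natAbs] at h hab
  omega

/-- Minimality of (roughly) half the lattice vector `(s - γ, -(λ + 1))`, with `e` accounting for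
the parity of `λ`. -/
theorem half_long_diagonal_le {s lam gam e w z : ℤ} (hs : 1 ≤ s) (hgam : 1 ≤ gam)
    (hlg : gam ≤ lam) (he0 : 0 ≤ e) (hw : w % 2 = 1) (hz : z % 2 = 1) :
    s - gam + lam + 1 - e ≤ |w * s + z * gam| + |z * lam - w + e| := by
  have h1 := le_abs_self (w * s + z * gam)
  have h2 := neg_le_abs (w * s + z * gam)
  have h3 := le_abs_self (z * lam - w + e)
  have h4 := neg_le_abs (z * lam - w + e)
  have hw' : 1 ≤ w ∨ w ≤ -1 := by omega
  have hz' : 1 ≤ z ∨ z ≤ -1 := by omega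
  rcases hw' with hw' | hw' <;> rcases hz' with hz' | hz'
  · nlinarith [mul_nonneg (sub_nonneg.2 hw') (sub_nonneg.2 hs),
      mul_nonneg (sub_nonneg.2 hz') (by linarith : 0 ≤ gam + lam)]
  · nlinarith [mul_nonneg (sub_nonneg.2 hw') (by linarith : 0 ≤ s + 1),
      mul_nonneg (sub_nonneg.2 hz') (sub_nonneg.2 hlg)]
  · nlinarith [mul_nonneg (sub_nonneg.2 hw') (by linarith : 0 ≤ s + 1),
      mul_nonneg (sub_nonneg.2 hz') (sub_nonneg.2 hlg)]
  · nlinarith [mul_nonneg (sub_nonneg.2 hw') (sub_nonneg.2 hs),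
      mul_nonneg (sub_nonneg.2 hz') (by linarith : 0 ≤ gam + lam)]

/-- Minimality of (roughly) half the lattice vector `(γ, λ)`, with `e` accounting for the parity
of `λ`. -/
theorem half_short_diagonal_le {s lam gam e x z : ℤ} (hs : 1 ≤ s) (hgam : 1 ≤ gam)
    (hgs : gam ≤ s) (hlg : gam ≤ lam) (he0 : 0 ≤ e) (hz : z % 2 = 1) :
    gam + lam - e ≤ |2 * x * s + z * gam| + |z * lam - 2 * x - e| := by
  have h0 := abs_nonneg (2 * x * s + z * gam)
  have h1 := le_abs_self (2 * x * s + z * gam)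
  have h2 := neg_le_abs (2 * x * s + z * gam)
  have h3 := le_abs_self (z * lam - 2 * x - e)
  have h4 := neg_le_abs (z * lam - 2 * x - e)
  have hz' : z = 1 ∨ 3 ≤ z ∨ z = -1 ∨ z ≤ -3 := by omega
  have hx' : x = 0 ∨ 1 ≤ x ∨ x ≤ -1 := by omega
  rcases hz' with rfl | hz' | rfl | hz' <;> rcases hx' with rfl | hx' | hx'
  all_goals nlinarith

/-- `n` even, `s` even, `λ > γ > 0`: there exists a vertex `i` with
`d(0,i) = ⌈λ/2⌉ + (s-γ)/2` if `γ ≤ 2⌈(s-2)/4⌉`, and `= ⌊λ/2⌋ + γ/2` otherwise. -/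
theorem exists_vertex_dist_even_even (n s lam gam : ℕ) (hn : 5 ≤ n) (hs2 : 2 ≤ s)
    (hs : s ≤ (n - 1) / 2) (hne : Even n) (hse : Even s)
    (hlam : lam = n / s) (hgam : gam = n % s) (hgam0 : 0 < gam) (hlg : gam < lam) :
    ∃ i : ZMod n, (circulantGraph ({1, (s : ZMod n)} : Set (ZMod n))).dist 0 i =
      if gam ≤ 2 * ((s - 2 + 3) / 4) then (lam + 1) / 2 + (s - gam) / 2
      else lam / 2 + gam / 2 := by
  have hsn : s < n := by omega
  have hdiv : n = lam * s + gam := by rw [hlam, hgam, Nat.div_add_mod']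
  have hgs : gam < s := hgam ▸ Nat.mod_lt _ (by omega)
  have hge : Even gam := by
    rw [hdiv, Nat.even_add] at hne
    exact hne.1 (hse.mul_left lam)
  obtain ⟨g, rfl⟩ := hge
  obtain ⟨t, rfl⟩ := hse
  obtain ⟨h, e, he, hl⟩ : ∃ h e : ℕ, e ≤ 1 ∧ lam = 2 * h + e :=
    ⟨lam / 2, lam % 2, by omega, by omega⟩
  split_ifs with hcase
  · refine ⟨_, (dist_zero_eq_of_minimal (by omega) hsn (by omega) hdiv
      ((t : ℤ) - g) (-((h : ℤ) + e)) fun x y => ?_).trans (by omega)⟩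
    have key := half_long_diagonal_le (s := 2 * t) (lam := lam) (gam := 2 * g) (e := 1 - e)
      (w := 2 * x + 1) (z := 2 * y - 1) (by omega) (by omega) (by omega) (by omega) (by omega)
      (by omega)
    have h1 : (2 * x + 1) * (2 * t) + (2 * y - 1) * (2 * g)
        = 2 * ((t : ℤ) - g + x * (t + t : ℕ) + y * (g + g : ℕ)) := by push_cast; ring
    have h2 : (2 * y - 1) * lam - (2 * x + 1) + (1 - e)
        = 2 * (-((h : ℤ) + e) - x + y * lam) := by rw [hl]; push_cast; ring
    rw [h1, h2, abs_mul, abs_mul, abs_two] at key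
    rw [abs_of_nonneg (by omega : (0 : ℤ) ≤ t - g), abs_neg,
      abs_of_nonneg (by omega : (0 : ℤ) ≤ h + e)]
    omega
  · refine ⟨_, (dist_zero_eq_of_minimal (by omega) hsn (by omega) hdiv
      (g : ℤ) (h : ℤ) fun x y => ?_).trans (by omega)⟩
    have key := half_short_diagonal_le (s := 2 * t) (lam := lam) (gam := 2 * g) (e := e)
      (x := x) (z := 2 * y + 1) (by omega) (by omega) (by omega) (by omega) (by omega)
      (by omega)
    have h1 : 2 * x * (2 * t) + (2 * y + 1) * (2 * g)
        = 2 * ((g : ℤ) + x * (t + t : ℕ) + y * (g + g : ℕ)) := by push_cast; ring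
    have h2 : (2 * y + 1) * lam - 2 * x - e
        = 2 * ((h : ℤ) - x + y * lam) := by rw [hl]; push_cast; ring
    rw [h1, h2, abs_mul, abs_mul, abs_two] at key
    rw [Nat.abs_cast, Nat.abs_cast]
    omega
end

section
/- Let n ≥ 5 and s be integers with 2 ≤ s ≤ ⌊(n−1)/2⌋, with n odd, s odd, and λ > γ > 0. Then diam(C_n(1,s)) = ⌈λ/2⌉ + (s−1)/2 − (min(⌈(γ+1)/2⌉, ⌈(s−γ+2)/2⌉) − 1). -/
open SimpleGraph

section Lattice

variable {s l g D : ℤ}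

theorem exists_short_representation_of_nonneg (hs : 2 ≤ s) (hso : s % 2 = 1)
    (hpar : (l + g) % 2 = 1) (hg : 0 < g) (hgl : g < l) (hgs : g < s)
    (hD : D = (l + 1) / 2 + (s - 1) / 2 - (min ((g + 2) / 2) ((s - g + 3) / 2) - 1))
    {v : ℤ} (hv0 : 0 ≤ v) (hv : 2 * v ≤ l * s + g) :
    ∃ a b j : ℤ, a + b * s = v + j * (l * s + g) ∧ |a| + |b| ≤ D := by
  obtain ⟨x, y, hxy, hx1, hx2⟩ : ∃ x y : ℤ, v = x + y * s ∧ 2 * x < s ∧ -s < 2 * x := by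
    refine ⟨(v + s / 2) % s - s / 2, (v + s / 2) / s, ?_, ?_, ?_⟩
    · linarith [Int.emod_add_mul_ediv (v + s / 2) s, mul_comm s ((v + s / 2) / s)]
    · have := Int.emod_lt_of_pos (v + s / 2) (by lia : 0 < s)
      lia
    · have := Int.emod_nonneg (v + s / 2) (by lia : s ≠ 0)
      lia
  have hy0 : 0 ≤ y := by
    by_contra! h
    nlinarith
  have hy : 2 * y ≤ l + 1 := by
    by_contra! h
    nlinarith
  have hy1 : 2 * y = l + 1 → 2 * x + s ≤ g := fun h => by nlinarith
  have hy2 : 2 * y = l → 2 * x ≤ g := fun h => by nlinarith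
  have key : |x| + |y| ≤ D ∨ |x - g| + |y - l| ≤ D ∨ |x + s - g| + |y - 1 - l| ≤ D := by
    simp only [Int.abs_eq_natAbs] at *
    lia
  rcases key with h | h | h
  · exact ⟨x, y, 0, by rw [hxy]; ring, h⟩
  · exact ⟨x - g, y - l, -1, by rw [hxy]; ring, h⟩
  · exact ⟨x + s - g, y - 1 - l, -1, by rw [hxy]; ring, h⟩

theorem exists_short_representation_s7 (hs : 2 ≤ s) (hso : s % 2 = 1)
    (hpar : (l + g) % 2 = 1) (hg : 0 < g) (hgl : g < l) (hgs : g < s)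
    (hD : D = (l + 1) / 2 + (s - 1) / 2 - (min ((g + 2) / 2) ((s - g + 3) / 2) - 1))
    {v : ℤ} (hv : 2 * |v| ≤ l * s + g) :
    ∃ a b j : ℤ, a + b * s = v + j * (l * s + g) ∧ |a| + |b| ≤ D := by
  rcases le_total 0 v with h | h
  · exact exists_short_representation_of_nonneg hs hso hpar hg hgl hgs hD h
      (by rwa [abs_of_nonneg h] at hv)
  · obtain ⟨a, b, j, h1, h2⟩ := exists_short_representation_of_nonneg hs hso hpar hg hgl hgs hD
      (neg_nonneg.2 h) (by rwa [abs_of_nonpos h] at hv)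
    exact ⟨-a, -b, -j, by linear_combination -h1, by rwa [abs_neg, abs_neg]⟩

theorem exists_deep_point (hs : 2 ≤ s) (hso : s % 2 = 1)
    (hpar : (l + g) % 2 = 1) (hg : 0 < g) (hgl : g < l) (hgs : g < s)
    (hD : D = (l + 1) / 2 + (s - 1) / 2 - (min ((g + 2) / 2) ((s - g + 3) / 2) - 1)) :
    ∃ x y : ℤ, 2 * |x| < s ∧ 0 ≤ y ∧ 2 * y ≤ l + 1 ∧ ∀ i j : ℤ, |i| ≤ 1 → |j| ≤ 1 →
      D ≤ |x + i * s + j * g| + |y - i + j * l| := by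
  have key : ∀ x y : ℤ,
      (x = -((s - 1) / 2 - g / 2) ∧ y = (l + 1) / 2 ∧ D = x.natAbs + y ∨
        x = g / 2 ∧ y = l / 2 ∧ D = x.natAbs + y) →
      ∀ i j : ℤ, |i| ≤ 1 → |j| ≤ 1 → D ≤ |x + i * s + j * g| + |y - i + j * l| := by
    intro x y h i j hi hj
    simp only [Int.abs_eq_natAbs] at *
    obtain rfl | rfl | rfl : i = -1 ∨ i = 0 ∨ i = 1 := by lia
    all_goals
      obtain rfl | rfl | rfl : j = -1 ∨ j = 0 ∨ j = 1 := by lia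
      all_goals lia
  by_cases hc : D = (s - 1) / 2 - g / 2 + (l + 1) / 2
  · refine ⟨_, _, ?_, by lia, by lia, key (-((s - 1) / 2 - g / 2)) ((l + 1) / 2) (by lia)⟩
    simp only [Int.abs_eq_natAbs] at *
    lia
  · refine ⟨_, _, ?_, by lia, by lia, key (g / 2) (l / 2) (by lia)⟩
    simp only [Int.abs_eq_natAbs] at *
    lia

theorem exists_forall_representation_ge (hs : 2 ≤ s) (hso : s % 2 = 1)
    (hpar : (l + g) % 2 = 1) (hg : 0 < g) (hgl : g < l) (hgs : g < s)
    (hD : D = (l + 1) / 2 + (s - 1) / 2 - (min ((g + 2) / 2) ((s - g + 3) / 2) - 1)) :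
    ∃ v : ℤ, ∀ a b j : ℤ, a + b * s = v + j * (l * s + g) → D ≤ |a| + |b| := by
  classical
  obtain ⟨x, y, hx, hy0, hy, hxy⟩ := exists_deep_point hs hso hpar hg hgl hgs hD
  let P : ℕ → Prop := fun m => ∃ a b j : ℤ,
    a + b * s = (x + y * s) + j * (l * s + g) ∧ a.natAbs + b.natAbs = m
  have hP : ∃ m, P m := ⟨_, x, y, 0, by ring, rfl⟩
  obtain ⟨a, b, j, hab, hm⟩ := Nat.find_spec hP
  have hmin : ∀ a' b' j' : ℤ, a' + b' * s = (x + y * s) + j' * (l * s + g) →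
      |a| + |b| ≤ |a'| + |b'| := by
    intro a' b' j' h
    have := Nat.find_min' hP ⟨a', b', j', h, rfl⟩
    simp only [Int.abs_eq_natAbs] at *
    lia
  refine ⟨x + y * s, fun a' b' j' h => le_trans ?_ (hmin a' b' j' h)⟩
  have h1 := hmin (a + s) (b - 1) j (by linear_combination hab)
  have h2 := hmin (a - s) (b + 1) j (by linear_combination hab)
  have h3 := hmin (a + g) (b + l) (j + 1) (by linear_combination hab)
  have h4 := hmin (a - g) (b - l) (j - 1) (by linear_combination hab)
  have ha : 2 * |a| ≤ s + 1 := by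
    simp only [Int.abs_eq_natAbs] at *
    lia
  have hb : 2 * |b| ≤ l + g := by
    simp only [Int.abs_eq_natAbs] at *
    lia
  have hax := abs_le.1 (by simp only [Int.abs_eq_natAbs] at *; lia : |a - x| ≤ s)
  have hb' := abs_le.1 (by lia : |b| ≤ (l + g) / 2)
  have hn : 0 < l * s + g := by nlinarith
  have hj : |j| ≤ 1 := by
    rw [abs_le]
    constructor
    · by_contra! h
      have hby : -(3 * l) ≤ 2 * (b - y) := by lia
      nlinarith [mul_le_mul_of_nonneg_right hby (by lia : 0 ≤ s),
        mul_le_mul_of_nonneg_right (by lia : j ≤ -2) hn.le,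
        mul_le_mul_of_nonneg_right (by lia : 2 ≤ l) (by lia : 0 ≤ s)]
    · by_contra! h
      have hby : 2 * (b - y) ≤ 3 * l := by lia
      nlinarith [mul_le_mul_of_nonneg_right hby (by lia : 0 ≤ s),
        mul_le_mul_of_nonneg_right (by lia : 2 ≤ j) hn.le,
        mul_le_mul_of_nonneg_right (by lia : 2 ≤ l) (by lia : 0 ≤ s)]
  have hi : a - x - j * g = (y + j * l - b) * s := by linear_combination hab
  have hi1 : |y + j * l - b| ≤ 1 := by
    have hjg : |j * g| ≤ g := by
      rw [abs_mul, abs_of_pos hg]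
      nlinarith
    have h5 : |a - x - j * g| < 2 * s := by
      have := abs_le.1 hjg
      rw [abs_lt]
      constructor <;> linarith
    rw [hi, abs_mul, abs_of_pos (by lia : 0 < s)] at h5
    have := lt_of_mul_lt_mul_right h5 (by lia : 0 ≤ s)
    lia
  have := hxy (y + j * l - b) j hi1 hj
  rwa [← hi, show x + (a - x - j * g) + j * g = a by ring,
    show y - (y + j * l - b) + j * l = b by ring] at this

end Lattice

section Circulant

variable {G : Type*} [AddCommGroup G] {c d : G}

theorem circulantGraph_pair_edist_add_zsmul_le {e : G} (he : e ∈ ({c, d} : Set G)) (u : G)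
    (a : ℤ) : (circulantGraph {c, d}).edist u (u + a • e) ≤ a.natAbs := by
  have step : ∀ w : G, (circulantGraph {c, d}).edist w (w + e) ≤ 1 := by
    intro w
    rw [edist_le_one_iff_adj_or_eq, circulantGraph_adj]
    by_cases h : w = w + e
    · exact Or.inr h
    · exact Or.inl ⟨h, Or.inr (by simpa using he)⟩
  have nat_case : ∀ (m : ℕ) (w : G), (circulantGraph {c, d}).edist w (w + m • e) ≤ m := by
    intro m
    induction m with
    | zero => simp
    | succ m ih =>
      intro w
      refine (SimpleGraph.edist_triangle (v := w + m • e)).trans ?_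
      rw [succ_nsmul, ← add_assoc, Nat.cast_succ]
      exact add_le_add (ih w) (step _)
  obtain h | h := Int.natAbs_eq a
  · conv_lhs => rw [h]
    rw [natCast_zsmul]
    exact nat_case _ u
  · have hu : u + a • e + a.natAbs • e = u := by
      rw [add_assoc, ← natCast_zsmul, ← add_smul, show a + (a.natAbs : ℤ) = 0 by lia, zero_smul,
        add_zero]
    have := nat_case a.natAbs (u + a • e)
    rwa [hu, SimpleGraph.edist_comm] at this

theorem circulantGraph_pair_edist_le (u : G) (a b : ℤ) :
    (circulantGraph {c, d}).edist u (u + a • c + b • d) ≤ (a.natAbs + b.natAbs : ℕ) := by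
  rw [Nat.cast_add]
  exact (SimpleGraph.edist_triangle (v := u + a • c)).trans
    (add_le_add (circulantGraph_pair_edist_add_zsmul_le (by simp) _ _)
      (circulantGraph_pair_edist_add_zsmul_le (by simp) _ _))

theorem circulantGraph_pair_exists_of_walk {u v : G} (w : (circulantGraph {c, d}).Walk u v) :
    ∃ a b : ℤ, v = u + a • c + b • d ∧ a.natAbs + b.natAbs ≤ w.length := by
  induction w with
  | nil => exact ⟨0, 0, by simp⟩
  | @cons x y z h w ih =>
    obtain ⟨a, b, rfl, hab⟩ := ih
    rw [circulantGraph_adj] at h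
    simp only [Set.mem_insert_iff, Set.mem_singleton_iff] at h
    rw [Walk.length_cons]
    rcases h.2 with (h | h) | (h | h)
    · exact ⟨a - 1, b, by rw [sub_smul, one_smul, ← h]; abel, by lia⟩
    · exact ⟨a, b - 1, by rw [sub_smul, one_smul, ← h]; abel, by lia⟩
    · exact ⟨a + 1, b, by rw [add_smul, one_smul, ← h]; abel, by lia⟩
    · exact ⟨a, b + 1, by rw [add_smul, one_smul, ← h]; abel, by lia⟩

theorem circulantGraph_pair_diam_eq {D : ℕ}
    (hle : ∀ z : G, ∃ a b : ℤ, z = a • c + b • d ∧ a.natAbs + b.natAbs ≤ D)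
    (hge : ∃ z : G, ∀ a b : ℤ, z = a • c + b • d → D ≤ a.natAbs + b.natAbs) :
    (circulantGraph {c, d}).diam = D := by
  have hup : (circulantGraph {c, d}).ediam ≤ D := by
    refine ediam_le_of_edist_le fun u v => ?_
    obtain ⟨a, b, h, hD⟩ := hle (v - u)
    have hv : v = u + a • c + b • d := by rw [add_assoc, ← h]; abel
    rw [hv]
    exact (circulantGraph_pair_edist_le u a b).trans (by exact_mod_cast hD)
  have htop : (circulantGraph {c, d}).ediam ≠ ⊤ := ne_top_of_le_ne_top (ENat.natCast_ne_top D) hup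
  refine le_antisymm (ENat.toNat_le_of_le_natCast hup) ?_
  obtain ⟨z, hz⟩ := hge
  obtain ⟨w, hw⟩ := (connected_of_ediam_ne_top htop).exists_walk_length_eq_dist 0 z
  obtain ⟨a, b, h, hab⟩ := circulantGraph_pair_exists_of_walk w
  calc D ≤ a.natAbs + b.natAbs := hz a b (by rw [h, zero_add])
    _ ≤ w.length := hab
    _ = (circulantGraph {c, d}).dist 0 z := hw
    _ ≤ _ := dist_le_diam htop

end Circulant

/-- `n` odd, `s` odd, `λ > γ > 0`:
`diam(C_n(1,s)) = ⌈λ/2⌉ + (s-1)/2 - (min(⌈(γ+1)/2⌉, ⌈(s-γ+2)/2⌉) - 1)`. -/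
theorem diam_circulant_odd_odd (n s lam gam : ℕ) (hn : 5 ≤ n) (hs2 : 2 ≤ s)
    (hs : s ≤ (n - 1) / 2) (hno : Odd n) (hso : Odd s)
    (hlam : lam = n / s) (hgam : gam = n % s) (hgam0 : 0 < gam) (hlg : gam < lam) :
    (circulantGraph ({1, (s : ZMod n)} : Set (ZMod n))).diam =
      (lam + 1) / 2 + (s - 1) / 2 - (min ((gam + 2) / 2) ((s - gam + 3) / 2) - 1) := by
  have : NeZero n := ⟨by lia⟩
  have hgs : gam < s := hgam ▸ Nat.mod_lt n (by lia)
  have hN : n = lam * s + gam := by rw [hlam, hgam, mul_comm, Nat.div_add_mod]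
  have hNz : (n : ℤ) = lam * s + gam := by exact_mod_cast hN
  have hso' : (s : ℤ) % 2 = 1 := by have := Nat.odd_iff.1 hso; lia
  have hpar : ((lam : ℤ) + gam) % 2 = 1 := by
    have h : Odd (lam + gam) := by
      rw [hN, Nat.odd_add, Nat.odd_mul] at hno
      rw [Nat.odd_add]
      tauto
    have := Nat.odd_iff.1 h
    lia
  set D := (lam + 1) / 2 + (s - 1) / 2 - (min ((gam + 2) / 2) ((s - gam + 3) / 2) - 1) with hD
  have hDz : (D : ℤ) = ((lam : ℤ) + 1) / 2 + ((s : ℤ) - 1) / 2 -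
      (min (((gam : ℤ) + 2) / 2) (((s : ℤ) - gam + 3) / 2) - 1) := by
    lia
  have hs2' : (2 : ℤ) ≤ s := by lia
  have hg0' : (0 : ℤ) < gam := by lia
  have hlg' : (gam : ℤ) < lam := by lia
  have hgs' : (gam : ℤ) < s := by lia
  apply circulantGraph_pair_diam_eq
  · intro z
    have hz : 2 * |z.valMinAbs| ≤ (lam : ℤ) * s + gam := by
      rw [← hNz]
      have := ZMod.natAbs_valMinAbs_le z
      simp only [Int.abs_eq_natAbs] at *
      lia
    obtain ⟨a, b, j, h, hab⟩ :=
      exists_short_representation_s7 hs2' hso' hpar hg0' hlg' hgs' hDz hz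
    refine ⟨a, b, ?_, by simp only [Int.abs_eq_natAbs] at *; lia⟩
    have := congrArg (Int.cast : ℤ → ZMod n) h
    rw [← hNz] at this
    push_cast at this
    simpa using this.symm
  · obtain ⟨v, hv⟩ := exists_forall_representation_ge hs2' hso' hpar hg0' hlg' hgs' hDz
    refine ⟨(v : ZMod n), fun a b h => ?_⟩
    have h' : ((v : ℤ) : ZMod n) = ((a + b * s : ℤ) : ZMod n) := by
      rw [h]; simp
    rw [ZMod.intCast_eq_intCast_iff_dvd_sub] at h'
    obtain ⟨j, hj⟩ := h'
    have := hv a b j (by rw [← hNz]; linear_combination hj)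
    simp only [Int.abs_eq_natAbs] at *
    lia
end

section
/- Let n ≥ 5 and s be integers with 2 ≤ s ≤ ⌊(n−1)/2⌋, with n odd, s odd, and λ > γ > 0. Then diam(C_n(1,s)) ≤ ⌈λ/2⌉ + (s−1)/2 − (min(⌈(γ+1)/2⌉, ⌈(s−γ+2)/2⌉) − 1). -/
open SimpleGraph

namespace SimpleGraph

variable {G : Type*}

lemma circulantGraph_edist_add_nsmul_le [AddCommGroup G] {S : Set G} {a : G} (ha : a ∈ S)
    (u : G) (k : ℕ) : (circulantGraph S).edist u (u + k • a) ≤ k := by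
  induction k with
  | zero => simp
  | succ k ih =>
    have step : (circulantGraph S).edist (u + k • a) (u + (k + 1) • a) ≤ 1 := by
      rw [edist_le_one_iff_adj_or_eq, circulantGraph_adj]
      by_cases h : u + k • a = u + (k + 1) • a
      · exact Or.inr h
      · refine Or.inl ⟨h, Or.inr ?_⟩
        rwa [add_sub_add_left_eq_sub, succ_nsmul, add_sub_cancel_left]
    push_cast
    exact SimpleGraph.edist_triangle.trans (add_le_add ih step)

lemma circulantGraph_edist_add_zsmul_le [AddCommGroup G] {S : Set G} {a : G} (ha : a ∈ S)
    (u : G) (k : ℤ) : (circulantGraph S).edist u (u + k • a) ≤ k.natAbs := by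
  obtain h | h := Int.natAbs_eq k
  · have := circulantGraph_edist_add_nsmul_le ha u k.natAbs
    rwa [← natCast_zsmul, ← h] at this
  · have := circulantGraph_edist_add_nsmul_le ha (u + k • a) k.natAbs
    rw [edist_comm]
    rwa [← natCast_zsmul, add_assoc, ← add_smul, show k + (k.natAbs : ℤ) = 0 by omega,
      zero_smul, add_zero] at this

lemma circulantGraph_edist_le_of_sub_eq [AddCommGroup G] {S : Set G} {a b u v : G} (ha : a ∈ S)
    (hb : b ∈ S) {x y : ℤ} (h : v - u = x • a + y • b) {B : ℕ} (hB : |x| + |y| ≤ B) :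
    (circulantGraph S).edist u v ≤ B := by
  obtain rfl : v = u + x • a + y • b := by rw [add_assoc, ← h, add_sub_cancel]
  calc (circulantGraph S).edist u (u + x • a + y • b)
      ≤ x.natAbs + y.natAbs := SimpleGraph.edist_triangle.trans <|
        add_le_add (circulantGraph_edist_add_zsmul_le ha u x)
          (circulantGraph_edist_add_zsmul_le hb _ y)
    _ ≤ B := by
        rw [Int.abs_eq_natAbs, Int.abs_eq_natAbs] at hB
        exact_mod_cast hB

end SimpleGraph

/-- One of the four short representations of the residue of `q * s + r` modulo `l * s + g`
by multiples of `1` and `s` has length at most the bound. -/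
lemma exists_representation_le (s l g q r B : ℤ) (hso : s % 2 = 1) (hlg : (l + g) % 2 = 1)
    (hgl : g < l) (hr : 0 ≤ r) (hrs : r < s) (hq : 0 ≤ q) (hql : q ≤ l)
    (hB : (l + 1) / 2 + (s - 1) / 2 - (min ((g + 2) / 2) ((s - g + 3) / 2) - 1) ≤ B) :
    ∃ x y z : ℤ, q * s + r = x + y * s + z * (l * s + g) ∧ |x| + |y| ≤ B := by
  by_cases h₁ : |r| + |q| ≤ B
  · exact ⟨r, q, 0, by ring, h₁⟩
  by_cases h₂ : |r - s| + |q + 1| ≤ B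
  · exact ⟨r - s, q + 1, 0, by ring, h₂⟩
  by_cases h₃ : |r - g| + |q - l| ≤ B
  · exact ⟨r - g, q - l, 1, by ring, h₃⟩
  by_cases h₄ : |r - g - s| + |q - l + 1| ≤ B
  · exact ⟨r - g - s, q - l + 1, 1, by ring, h₄⟩
  exfalso
  rw [abs_of_nonneg hr, abs_of_nonneg hq] at h₁
  rw [abs_of_neg (by omega), abs_of_nonneg (by omega)] at h₂
  rcases abs_cases (r - g) with h | h <;> rcases abs_cases (q - l) with h' | h' <;>
    rcases abs_cases (r - g - s) with k | k <;> rcases abs_cases (q - l + 1) with k' | k' <;>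
    rcases min_cases ((g + 2) / 2) ((s - g + 3) / 2) with m | m <;> omega

/-- `n` odd, `s` odd, `λ > γ > 0`:
`diam(C_n(1,s)) ≤ ⌈λ/2⌉ + (s-1)/2 - (min(⌈(γ+1)/2⌉, ⌈(s-γ+2)/2⌉) - 1)`. -/
theorem diam_circulant_odd_odd_le (n s lam gam : ℕ) (hn : 5 ≤ n) (hs2 : 2 ≤ s)
    (hs : s ≤ (n - 1) / 2) (hno : Odd n) (hso : Odd s)
    (hlam : lam = n / s) (hgam : gam = n % s) (hgam0 : 0 < gam) (hlg : gam < lam) :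
    (circulantGraph ({1, (s : ZMod n)} : Set (ZMod n))).diam ≤
      (lam + 1) / 2 + (s - 1) / 2 - (min ((gam + 2) / 2) ((s - gam + 3) / 2) - 1) := by
  have : NeZero n := ⟨by omega⟩
  have hgs : gam < s := hgam ▸ Nat.mod_lt _ (by omega)
  have hn_eq : n = lam * s + gam := by rw [hlam, hgam, Nat.div_add_mod']
  have hpar : (lam + gam) % 2 = 1 := by
    rw [hn_eq] at hno
    rw [← Nat.odd_iff]
    simpa [Nat.odd_add, Nat.odd_mul, hso] using hno
  have hso' := Nat.odd_iff.mp hso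
  refine ENat.toNat_le_of_le_natCast (ediam_le_of_edist_le fun u v => ?_)
  have hw : (v - u).val < n := ZMod.val_lt _
  have hdiv := Nat.div_add_mod' (v - u).val s
  have hql : (v - u).val / s ≤ lam := hlam ▸ Nat.div_le_div_right hw.le
  have hrs : (v - u).val % s < s := Nat.mod_lt _ (by omega)
  obtain ⟨x, y, z, hxyz, hB⟩ := exists_representation_le s lam gam ((v - u).val / s : ℕ)
    ((v - u).val % s : ℕ)
    ((lam + 1) / 2 + (s - 1) / 2 - (min ((gam + 2) / 2) ((s - gam + 3) / 2) - 1) : ℕ)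
    (by omega) (by omega) (by omega) (Int.natCast_nonneg _) (by exact_mod_cast hrs)
    (Int.natCast_nonneg _) (by exact_mod_cast hql) (by omega)
  refine circulantGraph_edist_le_of_sub_eq (a := 1) (b := (s : ZMod n)) (by simp) (by simp)
    (x := x) (y := y) ?_ hB
  have hz : (lam : ℤ) * s + gam = n := by exact_mod_cast hn_eq.symm
  have hv : (((v - u).val / s : ℕ) : ℤ) * s + ((v - u).val % s : ℕ) = ((v - u).val : ℤ) := by
    exact_mod_cast hdiv
  rw [hz, hv] at hxyz
  have := congrArg (Int.cast : ℤ → ZMod n) hxyz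
  rw [Int.cast_natCast, ZMod.natCast_zmod_val] at this
  simpa using this
end

section
/- Let n ≥ 5 and s be integers with 2 ≤ s ≤ ⌊(n−1)/2⌋, with n odd, s odd, and λ > γ > 0. Then there exists a vertex i of C_n(1,s) such that d(0,i) = ⌈λ/2⌉ + (s−1)/2 − (min(⌈(γ+1)/2⌉, ⌈(s−γ+2)/2⌉) − 1). -/
open SimpleGraph

/-- Any vertex reached by a walk of length `ℓ` from `0` in `C_n(1,s)` is `x + s * y` for some
integers with `|x| + |y| ≤ ℓ`. -/
lemma exists_abs_add_abs_le_walk_length {n s : ℕ} {v : ZMod n}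
    (w : (circulantGraph ({1, (s : ZMod n)} : Set (ZMod n))).Walk v 0) :
    ∃ x y : ℤ, |x| + |y| ≤ w.length ∧ ((x + s * y : ℤ) : ZMod n) = v := by
  generalize hz : (0 : ZMod n) = z at w
  induction w with
  | nil => exact ⟨0, 0, by simp, by simpa using hz⟩
  | @cons a b c h p ih =>
    obtain ⟨x, y, hxy, hb⟩ := ih hz
    push_cast at hb
    have hx1 := abs_add_le x 1
    have hx2 := abs_sub x 1
    have hy1 := abs_add_le y 1
    have hy2 := abs_sub y 1
    rw [abs_one] at hx1 hx2 hy1 hy2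
    simp only [Walk.length_cons]
    rw [circulantGraph, fromRel_adj] at h
    simp only [Set.mem_insert_iff, Set.mem_singleton_iff] at h
    rcases h with ⟨-, (h | h) | (h | h)⟩
    · exact ⟨x + 1, y, by push_cast; linarith, by push_cast; linear_combination hb - h⟩
    · exact ⟨x, y + 1, by push_cast; linarith, by push_cast; linear_combination hb - h⟩
    · exact ⟨x - 1, y, by push_cast; linarith, by push_cast; linear_combination hb + h⟩
    · exact ⟨x, y - 1, by push_cast; linarith, by push_cast; linear_combination hb + h⟩

/-- If `D` is at most the cost of both natural ways of writing `q * s + r` as `x + s * y`, then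
it is at most the cost of any representation of `q * s + r + k * (l * s + g)` with `k ≥ 0`,
provided `0 ≤ g ≤ l`. -/
lemma le_abs_add_abs_of_eq {s l g q r D x y k : ℤ} (hs : 1 ≤ s) (hg : 0 ≤ g) (hgl : g ≤ l)
    (hk : 0 ≤ k) (h₁ : D ≤ q + r) (h₂ : D ≤ q + 1 + s - r)
    (h : x + s * y = q * s + r + k * (l * s + g)) : D ≤ |x| + |y| := by
  obtain ⟨x', rfl⟩ : ∃ x', x = x' + g * k := ⟨x - g * k, by ring⟩
  obtain ⟨y', rfl⟩ : ∃ y', y = y' + l * k := ⟨y - l * k, by ring⟩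
  have hx' : x' = s * (q - y') + r := by linear_combination h
  have hgk : 0 ≤ g * k := mul_nonneg hg hk
  have hlk : g * k ≤ l * k := mul_le_mul_of_nonneg_right hgl hk
  have := le_abs_self (x' + g * k)
  have := neg_abs_le (x' + g * k)
  have := le_abs_self (y' + l * k)
  have := abs_nonneg (y' + l * k)
  rcases le_or_gt y' q with hy | hy
  · have : q - y' ≤ s * (q - y') := le_mul_of_one_le_left (by linarith) hs
    rcases le_or_gt 0 y' with hy0 | hy0 <;> linarith
  · have : (y' - q - 1) ≤ s * (y' - q - 1) := le_mul_of_one_le_left (by linarith) hs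
    linarith

lemma circulantGraph_one_adj_natCast {n : ℕ} (hn : 1 < n) (t : ZMod n) (k : ℕ) :
    (circulantGraph ({1, t} : Set (ZMod n))).Adj (k : ZMod n) ((k + 1 : ℕ) : ZMod n) := by
  have : Fact (1 < n) := ⟨hn⟩
  rw [circulantGraph, fromRel_adj]
  refine ⟨by simp, Or.inr (Or.inl ?_)⟩
  push_cast
  ring

lemma circulantGraph_one_reachable_natCast {n : ℕ} (hn : 1 < n) (t : ZMod n) (k : ℕ) :
    (circulantGraph ({1, t} : Set (ZMod n))).Reachable 0 (k : ZMod n) := by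
  induction k with
  | zero => simp
  | succ k ih => exact ih.trans (circulantGraph_one_adj_natCast hn t k).reachable

/-- Every value up to the distance from `0` to `k` is attained as a distance from `0`. -/
lemma exists_dist_eq_of_le_dist {n : ℕ} (hn : 1 < n) (t : ZMod n) {D : ℕ} (k : ℕ)
    (h : D ≤ (circulantGraph ({1, t} : Set (ZMod n))).dist 0 (k : ZMod n)) :
    ∃ i : ZMod n, (circulantGraph ({1, t} : Set (ZMod n))).dist 0 i = D := by
  induction k with
  | zero => exact ⟨0, by simp at h; simp [h]⟩
  | succ k ih =>
    obtain ⟨w, hw⟩ := (circulantGraph_one_reachable_natCast hn t k).exists_walk_length_eq_dist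
    have hle := dist_le (w.concat (circulantGraph_one_adj_natCast hn t k))
    rw [Walk.length_concat, hw] at hle
    rcases h.eq_or_lt with h | h
    · exact ⟨_, h.symm⟩
    · exact ih (by omega)

/-- A lower bound for the distance from `0` to `q * s + r` in `C_n(1,s)`, in terms of the costs
of the two natural representations of `q * s + r` and of `n - (q * s + r) = q' * s + r'`. -/
lemma le_dist_circulantGraph_s9 {n s l g q r q' r' D : ℕ} (hn : 1 < n) (hs : 1 ≤ s) (hgl : g ≤ l)
    (hnl : n = l * s + g) (hsum : q * s + r + (q' * s + r') = n)
    (h₁ : D ≤ q + r) (h₂ : D + r ≤ q + 1 + s) (h₃ : D ≤ q' + r') (h₄ : D + r' ≤ q' + 1 + s) :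
    D ≤ (circulantGraph ({1, (s : ZMod n)} : Set (ZMod n))).dist 0
      ((q * s + r : ℕ) : ZMod n) := by
  obtain ⟨w, hw⟩ :=
    (circulantGraph_one_reachable_natCast hn (s : ZMod n) (q * s + r)).exists_walk_length_eq_dist
  obtain ⟨x, y, hxy, h⟩ := exists_abs_add_abs_le_walk_length w.reverse
  rw [Walk.length_reverse, hw] at hxy
  rw [← Int.cast_natCast (q * s + r), ZMod.intCast_eq_intCast_iff_dvd_sub] at h
  obtain ⟨k, hk⟩ := h
  zify at hsum hnl hs hgl h₁ h₂ h₃ h₄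
  push_cast at hk
  refine Int.ofNat_le.mp (le_trans ?_ hxy)
  rcases le_or_gt k 0 with hk0 | hk0
  · exact le_abs_add_abs_of_eq (l := l) (g := g) (q := q) (r := r) (k := -k) hs (by positivity)
      hgl (by linarith) h₁ (by linarith)
      (by linear_combination -hk - k * hnl)
  · rw [← abs_neg x, ← abs_neg y]
    exact le_abs_add_abs_of_eq (l := l) (g := g) (q := q') (r := r') (k := k - 1) hs
      (by positivity) hgl (by linarith) h₃ (by linarith)
      (by linear_combination hk - hsum + (k - 1) * hnl)

/-- `n` odd, `s` odd, `λ > γ > 0`: there exists a vertex `i` with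
`d(0,i) = ⌈λ/2⌉ + (s-1)/2 - (min(⌈(γ+1)/2⌉, ⌈(s-γ+2)/2⌉) - 1)`. -/
theorem exists_vertex_dist_odd_odd (n s lam gam : ℕ) (hn : 5 ≤ n) (hs2 : 2 ≤ s)
    (hs : s ≤ (n - 1) / 2) (hno : Odd n) (hso : Odd s)
    (hlam : lam = n / s) (hgam : gam = n % s) (hgam0 : 0 < gam) (hlg : gam < lam) :
    ∃ i : ZMod n, (circulantGraph ({1, (s : ZMod n)} : Set (ZMod n))).dist 0 i =
      (lam + 1) / 2 + (s - 1) / 2 - (min ((gam + 2) / 2) ((s - gam + 3) / 2) - 1) := by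
  have hgs : gam < s := hgam ▸ Nat.mod_lt n (by omega)
  have hnl : n = lam * s + gam := by
    rw [hlam, hgam, mul_comm]
    exact (Nat.div_add_mod n s).symm
  suffices h : ∃ q r q' r' : ℕ, q * s + r + (q' * s + r') = n ∧
      ∀ D, D = (lam + 1) / 2 + (s - 1) / 2 - (min ((gam + 2) / 2) ((s - gam + 3) / 2) - 1) →
        D ≤ q + r ∧ D + r ≤ q + 1 + s ∧ D ≤ q' + r' ∧ D + r' ≤ q' + 1 + s by
    obtain ⟨q, r, q', r', hsum, hD⟩ := h
    obtain ⟨h₁, h₂, h₃, h₄⟩ := hD _ rfl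
    exact exists_dist_eq_of_le_dist (by omega) _ _
      (le_dist_circulantGraph_s9 (by omega) (by omega) hlg.le hnl hsum h₁ h₂ h₃ h₄)
  clear hlam hgam
  obtain ⟨t, rfl⟩ := hso
  rcases Nat.even_or_odd' lam with ⟨a, rfl | rfl⟩ <;>
    rcases Nat.even_or_odd' gam with ⟨b, rfl | rfl⟩
  · exact absurd (hnl ▸ hno) (by simp [parity_simps])
  · rcases le_total ((2 * b + 1 + 2) / 2) ((2 * t + 1 - (2 * b + 1) + 3) / 2) with hm | hm
    · obtain ⟨c, rfl⟩ : ∃ c, a = c + 1 := ⟨a - 1, by omega⟩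
      exact ⟨c + 1, t + b + 1, c, t + b + 1, by rw [hnl]; ring, fun D hD => by omega⟩
    · exact ⟨a, b, a, b + 1, by rw [hnl]; ring, fun D hD => by omega⟩
  · rcases le_total ((2 * b + 2) / 2) ((2 * t + 1 - 2 * b + 3) / 2) with hm | hm
    · exact ⟨a, t + b, a, t + b + 1, by rw [hnl]; ring, fun D hD => by omega⟩
    · exact ⟨a, b, a + 1, b, by rw [hnl]; ring, fun D hD => by omega⟩
  · exact absurd (hnl ▸ hno) (by simp [parity_simps])
end

section
/- Let n ≥ 5 and s be integers with 2 ≤ s ≤ ⌊(n−1)/2⌋, with n odd, s even, and λ > γ > 0. Then there exists a vertex i of C_n(1,s) such that: d(0,i) = ⌈λ/2⌉ + (s−2)/2 if γ = 1 or γ = s−1; d(0,i) = ⌊λ/2⌋ + (s−γ+1)/2 if 3 ≤ γ ≤ 2⌈s/4⌉ − 1; and d(0,i) = ⌈λ/2⌉ + (γ−1)/2 otherwise. -/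
open SimpleGraph

/-- The endpoint of a walk from `0` in `C_n(1,s)` has coordinates `x + y s` of `ℓ¹`-norm at most
the length of the walk. -/
lemma circulantGraph_exists_coords_of_walk {n s : ℕ} {u v : ZMod n}
    (p : (circulantGraph ({1, (s : ZMod n)} : Set (ZMod n))).Walk u v) :
    ∃ x y : ℤ, v - u = (x : ZMod n) + (y : ZMod n) * (s : ZMod n) ∧ |x| + |y| ≤ p.length := by
  induction p with
  | nil => exact ⟨0, 0, by simp, by simp⟩
  | @cons u w v h p ih =>
    obtain ⟨x, y, hxy, hl⟩ := ih
    have key : ∃ e f : ℤ, w - u = (e : ZMod n) + (f : ZMod n) * (s : ZMod n) ∧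
        |e| + |f| ≤ 1 := by
      simp only [circulantGraph, fromRel_adj, Set.mem_insert_iff, Set.mem_singleton_iff] at h
      obtain ⟨-, (h | h) | (h | h)⟩ := h
      · exact ⟨-1, 0, by push_cast; linear_combination -h, by norm_num⟩
      · exact ⟨0, -1, by push_cast; linear_combination -h, by norm_num⟩
      · exact ⟨1, 0, by push_cast; linear_combination h, by norm_num⟩
      · exact ⟨0, 1, by push_cast; linear_combination h, by norm_num⟩
    obtain ⟨e, f, hef, hl'⟩ := key
    refine ⟨x + e, y + f, by push_cast; linear_combination hxy + hef, ?_⟩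
    have h1 := abs_add_le x e
    have h2 := abs_add_le y f
    rw [Walk.length_cons]
    push_cast
    linarith

lemma circulantGraph_one_connected {n s : ℕ} (hn : 2 ≤ n) :
    (circulantGraph ({1, (s : ZMod n)} : Set (ZMod n))).Connected := by
  have : NeZero n := ⟨by omega⟩
  have : Fact (1 < n) := ⟨hn⟩
  have hr (j : ℕ) :
      (circulantGraph ({1, (s : ZMod n)} : Set (ZMod n))).Reachable 0 (j : ZMod n) := by
    induction j with
    | zero => simp
    | succ j ih => exact ih.trans (Adj.reachable (by simp [circulantGraph]))
  rw [connected_iff_exists_forall_reachable]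
  refine ⟨0, fun w => ?_⟩
  simpa using hr w.val

/-- Every value up to the distance of some vertex from `u` is attained as a distance from `u`. -/
lemma SimpleGraph.Connected.exists_dist_eq {V : Type*} {G : SimpleGraph V} (hG : G.Connected)
    {u v : V} {k : ℕ} (hk : k ≤ G.dist u v) : ∃ w, G.dist u w = k := by
  obtain ⟨p, hp⟩ := hG.exists_walk_length_eq_dist u v
  refine ⟨p.getVert k, le_antisymm ?_ ?_⟩
  · refine (dist_le (p.take k)).trans ?_
    simp
  · have h1 := hG.dist_triangle (u := u) (v := p.getVert k) (w := v)
    have h2 := dist_le (p.drop k)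
    rw [Walk.drop_length] at h2
    omega

/-- A lower bound for all `ℓ¹`-norms in a coset of the lattice of relations of `C_n(1,s)` gives
a vertex at exactly that distance from `0`. -/
lemma circulantGraph_exists_dist_eq {n s l g V : ℕ} (hn : 2 ≤ n) (hd : n = l * s + g) (x₀ y₀ : ℤ)
    (h : ∀ a b : ℤ, (V : ℤ) ≤ |x₀ - a * s - b * g| + |y₀ + a - b * l|) :
    ∃ i : ZMod n, (circulantGraph ({1, (s : ZMod n)} : Set (ZMod n))).dist 0 i = V := by
  have hc := circulantGraph_one_connected (s := s) hn
  apply hc.exists_dist_eq (v := (x₀ : ZMod n) + (y₀ : ZMod n) * (s : ZMod n))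
  obtain ⟨p, hp⟩ := hc.exists_walk_length_eq_dist 0
    ((x₀ : ZMod n) + (y₀ : ZMod n) * (s : ZMod n))
  obtain ⟨x, y, hxy, hl⟩ := circulantGraph_exists_coords_of_walk p
  have hdvd : (n : ℤ) ∣ x - x₀ + (y - y₀) * s := by
    rw [← ZMod.intCast_zmod_eq_zero_iff_dvd]
    push_cast
    linear_combination -hxy
  obtain ⟨k, hk⟩ := hdvd
  have hd' : (n : ℤ) = l * s + g := by exact_mod_cast hd
  have h' := h (y - y₀ - k * l) (-k)
  have e1 : x₀ - (y - y₀ - k * l) * s - -k * g = x := by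
    linear_combination -hk - k * hd'
  have e2 : y₀ + (y - y₀ - k * l) - -k * l = y := by ring
  rw [e1, e2] at h'
  rw [← hp]
  exact_mod_cast h'.trans hl

/-- Norm bound near the middle of the relation `(g, l)`. -/
lemma le_l1_norm_of_lower_gap {s l g V x y : ℤ} (hs : 2 ≤ s) (hg : 0 ≤ g) (hlg : g ≤ l)
    (h1 : V ≤ x + y) (h2 : x + y ≤ l + g - V) (h3 : V - s - 1 - l + g ≤ x - y)
    (h4 : x - y ≤ s + 1 - V) (a b : ℤ) : V ≤ |x - a * s - b * g| + |y + a - b * l| := by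
  have p1 := le_abs_self (x - a * s - b * g)
  have p2 := neg_le_abs (x - a * s - b * g)
  have q1 := le_abs_self (y + a - b * l)
  have q2 := neg_le_abs (y + a - b * l)
  rcases le_or_gt b 0 with hb | hb
  · rcases le_or_gt a 0 with ha | ha
    · nlinarith [mul_nonneg (neg_nonneg.2 hb) (by linarith : 0 ≤ g + l),
        mul_nonneg (neg_nonneg.2 ha) (by linarith : 0 ≤ s - 1)]
    · nlinarith [mul_nonneg (neg_nonneg.2 hb) (by linarith : 0 ≤ l - g),
        mul_nonneg (by linarith : 0 ≤ a - 1) (by linarith : 0 ≤ s + 1)]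
  · rcases le_or_gt 0 a with ha | ha
    · nlinarith [mul_nonneg (by linarith : 0 ≤ b - 1) (by linarith : 0 ≤ g + l),
        mul_nonneg ha (by linarith : 0 ≤ s - 1)]
    · nlinarith [mul_nonneg (by linarith : 0 ≤ b - 1) (by linarith : 0 ≤ l - g),
        mul_nonneg (by linarith : 0 ≤ -1 - a) (by linarith : 0 ≤ s + 1)]

/-- Norm bound between the relations `(g, l)` and `(s, -1)`. -/
lemma le_l1_norm_of_upper_gap {s l g V x y : ℤ} (hs : 2 ≤ s) (hg : 0 ≤ g) (hlg : g ≤ l)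
    (h1 : V ≤ x + y) (h2 : x + y ≤ l + g + s - 1 - V) (h3 : V - l + g ≤ x - y)
    (h4 : x - y ≤ s + 1 - V) (a b : ℤ) : V ≤ |x - a * s - b * g| + |y + a - b * l| := by
  have p1 := le_abs_self (x - a * s - b * g)
  have p2 := neg_le_abs (x - a * s - b * g)
  have q1 := le_abs_self (y + a - b * l)
  have q2 := neg_le_abs (y + a - b * l)
  rcases le_or_gt b 0 with hb | hb
  · rcases le_or_gt a 0 with ha | ha
    · nlinarith [mul_nonneg (neg_nonneg.2 hb) (by linarith : 0 ≤ g + l),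
        mul_nonneg (neg_nonneg.2 ha) (by linarith : 0 ≤ s - 1)]
    · nlinarith [mul_nonneg (neg_nonneg.2 hb) (by linarith : 0 ≤ l - g),
        mul_nonneg (by linarith : 0 ≤ a - 1) (by linarith : 0 ≤ s + 1)]
  · rcases le_or_gt a 0 with ha | ha
    · nlinarith [mul_nonneg (by linarith : 0 ≤ b - 1) (by linarith : 0 ≤ l - g),
        mul_nonneg (neg_nonneg.2 ha) (by linarith : 0 ≤ s + 1)]
    · nlinarith [mul_nonneg (by linarith : 0 ≤ b - 1) (by linarith : 0 ≤ g + l),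
        mul_nonneg (by linarith : 0 ≤ a - 1) (by linarith : 0 ≤ s - 1)]

lemma circulantGraph_exists_dist_eq_of_lower_gap {n s l g V : ℕ} (hn : 2 ≤ n)
    (hd : n = l * s + g) (hs : 2 ≤ s) (hgs : g < s) (hlg : g ≤ l) (hV : 2 * V ≤ l + g) :
    ∃ i : ZMod n, (circulantGraph ({1, (s : ZMod n)} : Set (ZMod n))).dist 0 i = V := by
  obtain ⟨x, y, h1, h2, h3, h4⟩ : ∃ x y : ℤ, (V : ℤ) ≤ x + y ∧ x + y ≤ l + g - V ∧
      (V : ℤ) - s - 1 - l + g ≤ x - y ∧ x - y ≤ s + 1 - V :=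
    ⟨(s + 1) / 2, V - (s + 1) / 2, by omega, by omega, by omega, by omega⟩
  exact circulantGraph_exists_dist_eq hn hd x y
    (le_l1_norm_of_lower_gap (by omega) (by omega) (by omega) h1 h2 h3 h4)

lemma circulantGraph_exists_dist_eq_of_upper_gap {n s l g V : ℕ} (hn : 2 ≤ n)
    (hd : n = l * s + g) (hs : 2 ≤ s) (hlg : g ≤ l) (hV : 2 * V + g ≤ l + s + 1)
    (hV' : 2 * V + 2 ≤ l + g + s) :
    ∃ i : ZMod n, (circulantGraph ({1, (s : ZMod n)} : Set (ZMod n))).dist 0 i = V := by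
  obtain ⟨x, y, h1, h2, h3, h4⟩ : ∃ x y : ℤ, (V : ℤ) ≤ x + y ∧ x + y ≤ l + g + s - 1 - V ∧
      (V : ℤ) - l + g ≤ x - y ∧ x - y ≤ s + 1 - V :=
    ⟨(s + 2) / 2, V - (s + 1) / 2, by omega, by omega, by omega, by omega⟩
  exact circulantGraph_exists_dist_eq hn hd x y
    (le_l1_norm_of_upper_gap (by omega) (by omega) (by omega) h1 h2 h3 h4)

/-- `n` odd, `s` even, `λ > γ > 0`: there exists a vertex `i` with
`d(0,i) = ⌈λ/2⌉ + (s-2)/2` if `γ = 1` or `γ = s-1`;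
`= ⌊λ/2⌋ + (s-γ+1)/2` if `3 ≤ γ ≤ 2⌈s/4⌉ - 1`; and `= ⌈λ/2⌉ + (γ-1)/2` otherwise. -/
theorem exists_vertex_dist_odd_even (n s lam gam : ℕ) (hn : 5 ≤ n) (hs2 : 2 ≤ s)
    (hs : s ≤ (n - 1) / 2) (hno : Odd n) (hse : Even s)
    (hlam : lam = n / s) (hgam : gam = n % s) (hgam0 : 0 < gam) (hlg : gam < lam) :
    ∃ i : ZMod n, (circulantGraph ({1, (s : ZMod n)} : Set (ZMod n))).dist 0 i =
      if gam = 1 ∨ gam = s - 1 then (lam + 1) / 2 + (s - 2) / 2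
      else if 3 ≤ gam ∧ gam ≤ 2 * ((s + 3) / 4) - 1 then lam / 2 + (s - gam + 1) / 2
      else (lam + 1) / 2 + (gam - 1) / 2 := by
  have hd : n = lam * s + gam := by rw [hlam, hgam, Nat.div_add_mod']
  have hgs : gam < s := hgam ▸ Nat.mod_lt _ (by omega)
  have hgo : Odd gam := by
    rw [hd, Nat.odd_add'] at hno
    exact hno.2 (hse.mul_left lam)
  obtain ⟨t, ht⟩ := hse
  obtain ⟨r, hr⟩ := hgo
  split_ifs with hA hB
  · rcases hA with hA | hA
    · exact circulantGraph_exists_dist_eq_of_upper_gap (by omega) hd hs2 hlg.le (by omega)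
        (by omega)
    · exact circulantGraph_exists_dist_eq_of_lower_gap (by omega) hd hs2 hgs hlg.le (by omega)
  · exact circulantGraph_exists_dist_eq_of_upper_gap (by omega) hd hs2 hlg.le (by omega)
      (by omega)
  · exact circulantGraph_exists_dist_eq_of_lower_gap (by omega) hd hs2 hgs hlg.le (by omega)
end

section
/- Let n ≥ 5 and s be integers with 2 ≤ s ≤ ⌊(n−1)/2⌋, with γ > 0 and λ ≤ γ. Write s = a·γ + b where a = ⌊s/γ⌋ and b = s mod γ, and assume 0 < b < γ and b ≤ a·λ + 1. Define p₀ = ⌊(λ+γ)/2⌋, p₁ = ⌊(γ−b+(a+1)λ+1)/2⌋, p₂ = ⌊(γ+b+(a−1)λ+1)/2⌋, p₃ = ⌊(b+aλ+1)/2⌋, and e₁ = min(max(p₁,p₃), max(p₀,p₂)). Then diam(C_n(1,s)) = p₁ − 1 if p₁ = p₂ and (γ+b)(aλ−λ+1) is odd, and diam(C_n(1,s)) = e₁ otherwise. -/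
open SimpleGraph

namespace TwoStepCirculant

/-- `lam ≤ b` half of the covering bound: the `ℓ¹`-balls of radius `r` around the points of the
lattice generated by `(gam, lam)` and `(b, -c)` cover `ℤ²`. -/
theorem exists_lattice_near {gam lam b c r : ℤ} (hl : 0 ≤ lam) (hlb : lam ≤ b) (hbg : b < gam)
    (hbc : b ≤ c) (hc : 0 < c) (hr : b + c ≤ 2 * r + 1)
    (hr' : gam - b + c + lam ≤ 2 * r + 1 ∨
      gam + c = 2 * r + 2 ∧ b = lam ∧ b < c ∧ (c - b) % 2 = 1) (x y : ℤ) :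
    ∃ i j : ℤ, |x - (i * gam + j * b)| + |y - (i * lam - j * c)| ≤ r := by
  let F : ℤ → Prop := fun Q => ∃ i j : ℤ, Q = i * (gam - lam) + j * (c + b) ∧
    |i * (gam + lam) - j * (c - b) - (x + y)| ≤ r ∧ Q ≤ x - y + r
  have hne : ∃ Q, F Q := by
    have hN : 0 < gam + lam := by omega
    have hdet : 0 < gam * c + lam * b := by nlinarith [mul_nonneg hl (hl.trans hlb)]
    set k := (x + y + r) / (gam + lam)
    have h1 : k * (gam + lam) ≤ x + y + r := Int.ediv_mul_le _ hN.ne'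
    have h2 : x + y + r < (k + 1) * (gam + lam) := Int.lt_ediv_add_one_mul_self _ hN
    set M := |k * (gam - lam)| + |x - y + r|
    have h3 : k * (gam - lam) ≤ |k * (gam - lam)| := le_abs_self _
    have h4 : -(x - y + r) ≤ |x - y + r| := neg_le_abs _
    have hM0 : 0 ≤ M := by positivity
    refine ⟨_, k - M * (c - b), -(M * (gam + lam)), rfl, ?_, ?_⟩
    · have e : (k - M * (c - b)) * (gam + lam) - -(M * (gam + lam)) * (c - b) - (x + y)
          = k * (gam + lam) - (x + y) := by ring
      rw [e, abs_le]
      rw [add_mul] at h2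
      constructor <;> omega
    · have e : (k - M * (c - b)) * (gam - lam) + -(M * (gam + lam)) * (c + b)
          = k * (gam - lam) - 2 * (M * (gam * c + lam * b)) := by ring
      rw [e]
      have : M ≤ M * (gam * c + lam * b) := le_mul_of_one_le_right hM0 hdet
      omega
  obtain ⟨Q, ⟨i, j, hQ, hP, hle⟩, hmax⟩ :=
    Int.exists_greatest_of_bdd (P := F) ⟨x - y + r, fun _ ⟨_, _, _, _, h⟩ => h⟩ hne
  refine ⟨i, j, ?_⟩
  have hv := fun h1 h2 => hmax (Q + (c + b)) ⟨i, j + 1, by rw [hQ]; ring, h1, h2⟩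
  have hu := fun h1 h2 => hmax (Q + (gam - lam)) ⟨i + 1, j, by rw [hQ]; ring, h1, h2⟩
  have huv := fun h1 h2 =>
    hmax (Q + (gam - lam) + (c + b)) ⟨i + 1, j + 1, by rw [hQ]; ring, h1, h2⟩
  simp only [add_mul, one_mul, abs_le] at hv hu huv hP hQ
  simp only [mul_add, mul_sub] at hv hu huv hP hQ
  suffices x - y - r ≤ Q by
    rw [← le_sub_iff_add_le, abs_le, neg_sub, sub_le_iff_le_add, le_sub_iff_add_le]
    constructor <;> rcases abs_cases (y - (i * lam - j * c)) with h | h <;> omega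
  by_contra hlt
  omega

/-- A point at `ℓ¹`-distance at least `R` from the lattice generated by `(gam, lam)` and
`(b, -c)`, where `2 * R` is about the norm of the difference of the generators. -/
theorem exists_far_of_le_norm_sub {gam lam b c R : ℤ} (hl : 0 ≤ lam) (hlb : lam ≤ b)
    (hbg : b < gam) (hbc : b ≤ c)
    (hR : 2 * R + 1 ≤ gam - b + c + lam ∨
      2 * R = gam - b + c + lam ∧ (lam < b ∨ (c - b) % 2 = 0)) :
    ∃ x y : ℤ, ∀ i j : ℤ, R ≤ |x - (i * gam + j * b)| + |y - (i * lam - j * c)| := by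
  obtain ⟨x, y, h1, h2, h3, h4⟩ : ∃ x y : ℤ, R ≤ x - y ∧ x - y + R ≤ gam + b + c - lam ∧
      R - (c - b) ≤ x + y ∧ x + y + R ≤ gam + lam := by
    rcases Int.even_or_odd' (c - b) with ⟨m, hm | hm⟩
    · exact ⟨R - m, -m, by omega, by omega, by omega, by omega⟩
    · by_cases h : 2 * R + 1 ≤ gam - b + c + lam
      · exact ⟨R - m, -m, by omega, by omega, by omega, by omega⟩
      · exact ⟨R - m, -m - 1, by omega, by omega, by omega, by omega⟩
  refine ⟨x, y, fun i j => ?_⟩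
  have key : R ≤ |x - (i * gam + j * b) + (y - (i * lam - j * c))| ∨
      R ≤ |x - (i * gam + j * b) - (y - (i * lam - j * c))| := by
    have e1 : x - (i * gam + j * b) + (y - (i * lam - j * c))
        = (x + y) - i * (gam + lam) + j * (c - b) := by ring
    have e2 : x - (i * gam + j * b) - (y - (i * lam - j * c))
        = (x - y) - i * (gam - lam) - j * (c + b) := by ring
    rw [e1, e2, le_abs, le_abs]
    rcases le_or_gt i 0 with hi | hi <;> rcases le_or_gt j 0 with hj | hj
    · right; left; nlinarith
    · left; left; nlinarith
    · left; right; nlinarith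
    · right; right; nlinarith
  rcases key with h | h
  · exact h.trans (abs_add_le _ _)
  · exact h.trans (abs_sub _ _)

/-- A point at `ℓ¹`-distance at least `R` from the lattice generated by `(gam, lam)` and
`(b, -c)`, where `2 * R` is at most the norm of the second generator. -/
theorem exists_far_of_le_norm {gam lam b c R : ℤ} (hl : 0 ≤ lam) (hlb : lam ≤ b)
    (hbg : b < gam) (hbc : b ≤ c) (hR : 2 * R ≤ b + c) :
    ∃ x y : ℤ, ∀ i j : ℤ, R ≤ |x - (i * gam + j * b)| + |y - (i * lam - j * c)| := by
  obtain ⟨x, y, h1, h2, h3⟩ : ∃ x y : ℤ, x - y = R ∧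
      R - (gam - b + c + lam) ≤ x + y ∧ x + y + R ≤ gam + lam := by
    rcases Int.even_or_odd' (gam + lam) with ⟨m, hm | hm⟩
    · exact ⟨m, m - R, by omega, by omega, by omega⟩
    · exact ⟨m, m - R, by omega, by omega, by omega⟩
  refine ⟨x, y, fun i j => ?_⟩
  have key : R ≤ |x - (i * gam + j * b) + (y - (i * lam - j * c))| ∨
      R ≤ |x - (i * gam + j * b) - (y - (i * lam - j * c))| := by
    have e1 : x - (i * gam + j * b) + (y - (i * lam - j * c))
        = (x + y) - i * (gam + lam) + j * (c - b) := by ring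
    have e2 : x - (i * gam + j * b) - (y - (i * lam - j * c))
        = (x - y) - i * (gam - lam) - j * (c + b) := by ring
    rw [e1, e2, le_abs, le_abs]
    rcases le_or_gt i 0 with hi | hi <;> rcases le_or_gt j 0 with hj | hj
    · right; left; nlinarith
    · rcases hi.lt_or_eq with hi | rfl
      · left; left; nlinarith
      · right; right; nlinarith
    · left; right; nlinarith
    · right; right; nlinarith
  rcases key with h | h
  · exact h.trans (abs_add_le _ _)
  · exact h.trans (abs_sub _ _)

/-- The integer relations `x + y * s ≡ 0 (mod n)` form the lattice generated by `(gam, lam)` and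
`(b, -(a * lam + 1))`. -/
theorem dvd_add_mul_iff {n s lam gam a b : ℤ} (hn : n = lam * s + gam) (hs : s = a * gam + b)
    (x y : ℤ) :
    n ∣ x + y * s ↔ ∃ i j : ℤ, x = i * gam + j * b ∧ y = i * lam - j * (a * lam + 1) := by
  constructor
  · rintro ⟨k, hk⟩
    refine ⟨k + (k * lam - y) * a, k * lam - y, ?_, by ring⟩
    have : x = k * gam + (k * lam - y) * s := by rw [hn] at hk; linear_combination hk
    rw [this, hs]; ring
  · rintro ⟨i, j, rfl, rfl⟩
    refine ⟨i - j * a, ?_⟩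
    rw [hn]
    linear_combination (-j) * hs

section Graph

variable {n s : ℕ}

theorem adj_add_one (hn : 1 < n) (u : ZMod n) :
    (circulantGraph ({1, (s : ZMod n)} : Set (ZMod n))).Adj u (u + 1) := by
  have : Fact (1 < n) := ⟨hn⟩
  simp [circulantGraph_adj]

theorem adj_add_step (hs : 0 < s) (hsn : s < n) (u : ZMod n) :
    (circulantGraph ({1, (s : ZMod n)} : Set (ZMod n))).Adj u (u + s) := by
  have : (s : ZMod n) ≠ 0 := by
    rw [Ne, ZMod.natCast_eq_zero_iff]
    exact Nat.not_dvd_of_pos_of_lt hs hsn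
  simp [circulantGraph_adj, this]

/-- If `u` is always adjacent to `u + t`, then `u` and `u + x * t` are joined by a walk of length
`|x|`. -/
theorem exists_walk_add_mul {R : Type*} [Ring R] {G : SimpleGraph R} {t : R}
    (h : ∀ u, G.Adj u (u + t)) (x : ℤ) (u : R) :
    ∃ w : G.Walk u (u + x * t), w.length = x.natAbs := by
  have key : ∀ (m : ℕ) (u : R), ∃ w : G.Walk u (u + m * t), w.length = m := by
    intro m
    induction m with
    | zero => intro u; exact ⟨Walk.nil.copy rfl (by simp), by simp⟩
    | succ m ih =>
      intro u
      obtain ⟨w, hw⟩ := ih (u + t)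
      exact ⟨(Walk.cons (h u) w).copy rfl (by push_cast; noncomm_ring), by simp [hw]⟩
  obtain ⟨m, rfl | rfl⟩ := x.eq_nat_or_neg
  · rw [Int.cast_natCast, Int.natAbs_natCast]
    exact key m u
  · obtain ⟨w, hw⟩ := key m (u + ((-m : ℤ) : R) * t)
    exact ⟨(w.copy rfl (by push_cast; noncomm_ring)).reverse, by simp [hw]⟩

theorem exists_walk_length_le (hn : 1 < n) (hs : 0 < s) (hsn : s < n) (u : ZMod n) (x y : ℤ) :
    ∃ w : (circulantGraph ({1, (s : ZMod n)} : Set (ZMod n))).Walk u (u + x + y * s),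
      (w.length : ℤ) ≤ |x| + |y| := by
  obtain ⟨w₁, h₁⟩ := exists_walk_add_mul (adj_add_one (s := s) hn) x u
  obtain ⟨w₂, h₂⟩ := exists_walk_add_mul (adj_add_step hs hsn) y (u + x * 1)
  refine ⟨(w₁.append w₂).copy rfl (by simp), ?_⟩
  rw [Walk.length_copy, Walk.length_append, h₁, h₂]
  simp

theorem exists_eq_add_of_walk {u v : ZMod n}
    (w : (circulantGraph ({1, (s : ZMod n)} : Set (ZMod n))).Walk u v) :
    ∃ x y : ℤ, v = u + x + y * s ∧ |x| + |y| ≤ w.length := by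
  induction w with
  | nil => exact ⟨0, 0, by simp, by simp⟩
  | @cons u v' v h w ih =>
    obtain ⟨x, y, hv, hle⟩ := ih
    rw [Walk.length_cons]
    simp only [circulantGraph_adj, Set.mem_insert_iff, Set.mem_singleton_iff] at h
    have step : ∀ dx dy : ℤ, |dx| + |dy| ≤ 1 → v' = u + dx + dy * s →
        ∃ x y : ℤ, v = u + x + y * s ∧ |x| + |y| ≤ (w.length + 1 : ℕ) := by
      intro dx dy hd he
      refine ⟨x + dx, y + dy, by rw [hv, he]; push_cast; ring, ?_⟩
      have := abs_add_le x dx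
      have := abs_add_le y dy
      push_cast
      omega
    rcases h.2 with (h | h) | (h | h)
    · exact step (-1) 0 (by simp) (by push_cast; linear_combination -h)
    · exact step 0 (-1) (by simp) (by push_cast; linear_combination -h)
    · exact step 1 0 (by simp) (by push_cast; linear_combination h)
    · exact step 0 1 (by simp) (by push_cast; linear_combination h)

/-- The diameter of `C_n(1, s)` is the covering radius of its lattice of relations. -/
theorem diam_eq_of_covering {lam gam a b D : ℕ} (hs : 0 < s) (hsn : s < n) (hn1 : 1 < n)
    (hn : n = lam * s + gam) (hsab : s = a * gam + b)
    (hnear : ∀ x y : ℤ, ∃ i j : ℤ,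
      |x - (i * gam + j * b)| + |y - (i * lam - j * (a * lam + 1 : ℤ))| ≤ D)
    (hfar : ∃ x y : ℤ, ∀ i j : ℤ,
      (D : ℤ) ≤ |x - (i * gam + j * b)| + |y - (i * lam - j * (a * lam + 1 : ℤ))|) :
    (circulantGraph ({1, (s : ZMod n)} : Set (ZMod n))).diam = D := by
  set G := circulantGraph ({1, (s : ZMod n)} : Set (ZMod n))
  have : NeZero n := ⟨by omega⟩
  have hrel := dvd_add_mul_iff (n := n) (s := s) (lam := lam) (gam := gam) (a := a) (b := b)
    (by exact_mod_cast hn) (by exact_mod_cast hsab)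
  have hcast : ∀ x y : ℤ, ((x : ZMod n) + y * s = 0 ↔ (n : ℤ) ∣ x + y * s) := by
    intro x y
    rw [← ZMod.intCast_zmod_eq_zero_iff_dvd _ n]
    push_cast
    rfl
  have hwalk : ∀ u v : ZMod n, ∃ w : G.Walk u v, w.length ≤ D := by
    intro u v
    obtain ⟨z, hz⟩ := ZMod.intCast_surjective (v - u)
    obtain ⟨i, j, hij⟩ := hnear z 0
    have h0 := (hcast _ _).2 ((hrel _ _).2 ⟨i, j, rfl, rfl⟩)
    obtain ⟨w, hw⟩ := exists_walk_length_le hn1 hs hsn u (z - (i * gam + j * b))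
      (0 - (i * lam - j * (a * lam + 1 : ℤ)))
    refine ⟨w.copy rfl ?_, ?_⟩
    · push_cast at h0 ⊢
      linear_combination hz - h0
    · rw [Walk.length_copy]
      omega
  have hconn : G.Connected := ⟨fun u v => ⟨(hwalk u v).choose⟩⟩
  apply le_antisymm
  · obtain ⟨u, v, huv⟩ := G.exists_dist_eq_diam
    obtain ⟨w, hw⟩ := hwalk u v
    rw [← huv]
    exact (dist_le w).trans hw
  · obtain ⟨x, y, hxy⟩ := hfar
    refine le_trans ?_ (dist_le_diam (connected_iff_ediam_ne_top.1 hconn)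
      (u := 0) (v := (x : ZMod n) + y * s))
    obtain ⟨w, hw⟩ := hconn.exists_walk_length_eq_dist 0 ((x : ZMod n) + y * s)
    obtain ⟨x', y', hv, hle⟩ := exists_eq_add_of_walk w
    obtain ⟨i, j, hi, hj⟩ := (hrel (x - x') (y - y')).1 ((hcast _ _).1 (by
      push_cast; linear_combination hv))
    have := hxy i j
    rw [← hi, ← hj, sub_sub_cancel, sub_sub_cancel] at this
    rw [← hw]
    omega

end Graph

/-- The closed formula for the diameter, split by comparing `lam` with `b`. -/
theorem formula_cases {gam lam b t D : ℕ} (hbg : b < gam) (hbt : b ≤ t + 1)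
    (hlt : lam ≤ t)
    (hD : D = if (gam - b + (t + lam) + 1) / 2 = (gam + b + (t - lam) + 1) / 2 ∧
          (gam + b) % 2 = 1 ∧ (t - lam + 1) % 2 = 1 then
        (gam - b + (t + lam) + 1) / 2 - 1
      else
        min (max ((gam - b + (t + lam) + 1) / 2) ((b + t + 1) / 2))
            (max ((lam + gam) / 2) ((gam + b + (t - lam) + 1) / 2))) :
    (lam < b ∧ D = max ((gam - b + (t + lam) + 1) / 2) ((b + t + 1) / 2)) ∨
    (b < lam ∧ D = max ((lam + gam) / 2) ((gam + b + (t - lam) + 1) / 2)) ∨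
    (lam = b ∧ (gam + b) % 2 = 1 ∧ (t - lam) % 2 = 0 ∧ 2 * D + 2 = gam + t + 1) ∨
    (lam = b ∧ ((gam + b) % 2 = 0 ∨ (t - lam) % 2 = 1) ∧ D = (gam + t + 1) / 2) := by
  rcases lt_trichotomy lam b with h | rfl | h
  · refine .inl ⟨h, ?_⟩
    rw [hD, if_neg (by omega), min_eq_left]
    exact (max_le (by omega) (by omega)).trans (le_max_right _ _)
  · right; right
    split_ifs at hD with hc
    · left; omega
    · right
      rw [max_eq_left (by omega), max_eq_right (by omega)] at hD
      omega
  · refine .inr (.inl ⟨h, ?_⟩)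
    rw [hD, if_neg (by omega), min_eq_right]
    exact (max_le (by omega) (by omega)).trans (le_max_left _ _)

end TwoStepCirculant

open TwoStepCirculant in
/-- Case `λ ≤ γ`, `s = a·γ + b` with `0 < b < γ` and `b ≤ a·λ + 1`:
`diam(C_n(1,s)) = p₁ - 1` if `p₁ = p₂` and `(γ+b)(aλ-λ+1)` is odd, and `= e₁` otherwise,
where `p₀ = ⌊(λ+γ)/2⌋`, `p₁ = ⌊(γ-b+(a+1)λ+1)/2⌋`, `p₂ = ⌊(γ+b+(a-1)λ+1)/2⌋`,
`p₃ = ⌊(b+aλ+1)/2⌋`, `e₁ = min(max(p₁,p₃), max(p₀,p₂))`. -/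
theorem diam_circulant_lam_le_gam (n s lam gam a b : ℕ) (hn : 5 ≤ n) (hs2 : 2 ≤ s)
    (hs : s ≤ (n - 1) / 2)
    (hlam : lam = n / s) (hgam : gam = n % s) (hgam0 : 0 < gam) (hlg : lam ≤ gam)
    (ha : a = s / gam) (hb : b = s % gam) (hb0 : 0 < b) (hbg : b < gam)
    (hba : b ≤ a * lam + 1) :
    (circulantGraph ({1, (s : ZMod n)} : Set (ZMod n))).diam =
      if (gam - b + (a + 1) * lam + 1) / 2 = (gam + b + (a - 1) * lam + 1) / 2 ∧
          Odd ((gam + b) * (a * lam - lam + 1)) then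
        (gam - b + (a + 1) * lam + 1) / 2 - 1
      else
        min (max ((gam - b + (a + 1) * lam + 1) / 2) ((b + a * lam + 1) / 2))
            (max ((lam + gam) / 2) ((gam + b + (a - 1) * lam + 1) / 2)) := by
  have hsn : s < n := by omega
  have hn' : n = lam * s + gam := by rw [hlam, hgam, Nat.div_add_mod']
  have hs' : s = a * gam + b := by rw [ha, hb, Nat.div_add_mod']
  have ha1 : 1 ≤ a := by
    rw [ha]
    exact Nat.div_pos (hgam ▸ (Nat.mod_lt n (by omega)).le) hgam0
  have hla : lam ≤ a * lam := Nat.le_mul_of_pos_left lam ha1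
  have hadd : (a + 1) * lam = a * lam + lam := Nat.succ_mul a lam
  have hsub : (a - 1) * lam = a * lam - lam := Nat.sub_one_mul a lam
  have hodd : Odd ((gam + b) * (a * lam - lam + 1)) ↔
      (gam + b) % 2 = 1 ∧ (a * lam - lam + 1) % 2 = 1 := by
    rw [Nat.odd_mul, Nat.odd_iff, Nat.odd_iff]
  have hcast : (a * lam : ℤ) = ((a * lam : ℕ) : ℤ) := by push_cast; rfl
  simp only [hadd, hsub, hodd]
  refine (forall_eq (p := fun D => diam _ = D)).1 fun D hD => ?_
  replace hD := formula_cases hbg hba hla hD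
  apply diam_eq_of_covering (by omega) hsn (by omega) hn' hs'
  all_goals
    rw [hcast]
    clear hcast hadd hsub hodd hn hs hn' hs' hlam hgam ha hb
    generalize a * lam = t at *
  · intro x y
    rcases le_total lam b with h | h
    · refine exists_lattice_near (by omega) (by omega) (by omega) (by omega) (by omega) ?_ ?_ x y
      · omega
      · omega
    · obtain ⟨i, j, hij⟩ := exists_lattice_near (gam := t + 1) (lam := b) (b := lam) (c := gam)
        (r := D) (by omega) (by omega) (by omega) (by omega) (by omega)
        (by omega) (by omega) y (-x)
      refine ⟨j, -i, ?_⟩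
      rw [add_comm, ← abs_neg (x - _)]
      convert hij using 3 <;> ring
  · rcases le_total lam b with h | h
    · by_cases h3 : 2 * D ≤ b + t + 1
      · exact exists_far_of_le_norm (by omega) (by omega) (by omega) (by omega) (by omega)
      · exact exists_far_of_le_norm_sub (by omega) (by omega) (by omega) (by omega)
          (by omega)
    · obtain ⟨x, y, hxy⟩ : ∃ x y : ℤ, ∀ i j : ℤ,
          (D : ℤ) ≤ |x - (i * (t + 1) + j * lam)| + |y - (i * b - j * gam)| := by
        by_cases h3 : 2 * D ≤ lam + gam
        · exact exists_far_of_le_norm (by omega) (by omega) (by omega) (by omega) (by omega)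
        · exact exists_far_of_le_norm_sub (by omega) (by omega) (by omega) (by omega)
            (by omega)
      refine ⟨-y, x, fun i j => ?_⟩
      rw [add_comm, ← abs_neg (-y - _)]
      convert hxy (-j) i using 3 <;> ring
end

section
/- Let n ≥ 5 and s be integers with 2 ≤ s ≤ ⌊(n−1)/2⌋. Then diam(C_n(1,s)) ≤ ⌊⌊n/2⌋/s⌋ + ⌈s/2⌉. -/
open SimpleGraph

theorem edist_circulantGraph_add_nsmul_le {G : Type*} [AddGroup G] {S : Set G} {x : G}
    (hx : x ∈ S) (u : G) (k : ℕ) : (circulantGraph S).edist u (k • x + u) ≤ k := by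
  induction k with
  | zero => simp
  | succ k ih =>
    have hstep : (circulantGraph S).edist (k • x + u) ((k + 1) • x + u) ≤ 1 := by
      rw [edist_le_one_iff_adj_or_eq]
      by_cases h : k • x + u = (k + 1) • x + u
      · exact Or.inr h
      · refine Or.inl ((fromRel_adj _ _ _).2 ⟨h, Or.inr ?_⟩)
        simpa [succ_nsmul', add_assoc] using hx
    calc (circulantGraph S).edist u ((k + 1) • x + u)
        ≤ (circulantGraph S).edist u (k • x + u)
          + (circulantGraph S).edist (k • x + u) ((k + 1) • x + u) := SimpleGraph.edist_triangle
      _ ≤ k + 1 := add_le_add ih hstep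
      _ = ((k + 1 : ℕ) : ℕ∞) := by push_cast; rfl

theorem edist_circulantGraph_add_natCast_le {n s m : ℕ} (hs : 0 < s) (u : ZMod n) :
    (circulantGraph ({1, (s : ZMod n)} : Set (ZMod n))).edist u (m + u)
      ≤ (m / s + (s + 1) / 2 : ℕ) := by
  set G := circulantGraph ({1, (s : ZMod n)} : Set (ZMod n))
  have hone (w : ZMod n) (k : ℕ) : G.edist w (k + w) ≤ k := by
    simpa using edist_circulantGraph_add_nsmul_le
      (S := ({1, (s : ZMod n)} : Set (ZMod n))) (x := 1) (by simp) w k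
  have hjump (w : ZMod n) (k : ℕ) : G.edist w (k * s + w) ≤ k := by
    simpa using edist_circulantGraph_add_nsmul_le
      (S := ({1, (s : ZMod n)} : Set (ZMod n))) (x := (s : ZMod n)) (by simp) w k
  have hdiv : s * (m / s) + m % s = m := Nat.div_add_mod m s
  have hlt : m % s < s := Nat.mod_lt m hs
  by_cases hr : m % s ≤ (s + 1) / 2
  · have hend : (m : ZMod n) + u = (m % s : ℕ) + ((m / s : ℕ) * s + u) := by
      conv_lhs => rw [← hdiv]
      push_cast
      ring
    calc G.edist u (m + u)
        ≤ G.edist u ((m / s : ℕ) * s + u) + G.edist ((m / s : ℕ) * s + u) (m + u) :=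
          SimpleGraph.edist_triangle
      _ ≤ (m / s : ℕ) + (m % s : ℕ) := add_le_add (hjump _ _) (hend ▸ hone _ _)
      _ ≤ (m / s + (s + 1) / 2 : ℕ) := by
          rw [← Nat.cast_add]
          exact Nat.cast_le.2 (by omega)
  · have hend : ((m / s + 1 : ℕ) : ZMod n) * s + u = (s - m % s : ℕ) + (m + u) := by
      have : (m / s + 1) * s = (s - m % s) + m := by
        have : (m / s + 1) * s = s * (m / s) + s := by ring
        omega
      rw [← Nat.cast_mul, this, Nat.cast_add, add_assoc]
    calc G.edist u (m + u)
        ≤ G.edist u ((m / s + 1 : ℕ) * s + u) + G.edist ((m / s + 1 : ℕ) * s + u) (m + u) :=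
          SimpleGraph.edist_triangle
      _ ≤ (m / s + 1 : ℕ) + (s - m % s : ℕ) :=
          add_le_add (hjump _ _) (by rw [SimpleGraph.edist_comm, hend]; exact hone _ _)
      _ ≤ (m / s + (s + 1) / 2 : ℕ) := by
          rw [← Nat.cast_add]
          exact Nat.cast_le.2 (by omega)

/-- For all `n` and `s`: `diam(C_n(1,s)) ≤ ⌊⌊n/2⌋/s⌋ + ⌈s/2⌉`. -/
theorem diam_circulant_le (n s : ℕ) (hn : 5 ≤ n) (hs2 : 2 ≤ s) (hs : s ≤ (n - 1) / 2) :
    (circulantGraph ({1, (s : ZMod n)} : Set (ZMod n))).diam ≤ n / 2 / s + (s + 1) / 2 := by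
  have : NeZero n := ⟨by omega⟩
  refine ENat.toNat_le_of_le_natCast (ediam_le_of_edist_le fun u v ↦ ?_)
  set d := (v - u).valMinAbs.natAbs with hd
  have hle : ((d / s + (s + 1) / 2 : ℕ) : ℕ∞) ≤ (n / 2 / s + (s + 1) / 2 : ℕ) := by
    have : d / s ≤ n / 2 / s := Nat.div_le_div_right (ZMod.natAbs_valMinAbs_le (v - u))
    exact Nat.cast_le.2 (by omega)
  refine le_trans ?_ hle
  have hcast : (((v - u).valMinAbs : ℤ) : ZMod n) = v - u := ZMod.coe_valMinAbs _
  rcases Int.natAbs_eq (v - u).valMinAbs with h | h <;> rw [h, ← hd] at hcast <;>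
    push_cast at hcast
  · have hv : v = d + u := by rw [hcast]; ring
    rw [hv]
    exact edist_circulantGraph_add_natCast_le (by omega) u
  · have hu : u = d + v := by rw [neg_eq_iff_eq_neg.1 hcast]; ring
    rw [hu, SimpleGraph.edist_comm]
    exact edist_circulantGraph_add_natCast_le (by omega) v
end

section
/- Let n ≥ 5 and s be integers with 2 ≤ s ≤ ⌊(n−1)/2⌋, and let i be an integer with 0 ≤ i ≤ n−1, regarded as a vertex of C_n(1,s). For an integer t, set q = ⌊i/s⌋, r = i mod s, q_t = ⌊(t·n+i)/s⌋, r_t = (t·n+i) mod s, q̄_t = ⌊(t·n−i)/s⌋, r̄_t = (t·n−i) mod s. Then the distance d(0,i) in C_n(1,s) equals the minimum of the following quantities: r + q, 1 + s − r + q, and, over all integers t with 1 ≤ t ≤ s/gcd(n,s), the four quantities r_t + q_t, 1 + s − r_t + q_t, r̄_t + q̄_t, and 1 + s − r̄_t + q̄_t. -/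
open SimpleGraph

theorem exists_walk_add_nsmul_s18 {M : Type*} [AddCommGroup M] {G : SimpleGraph M} {c : M}
    (h : ∀ u, G.Adj u (u + c)) (k : ℕ) (u : M) :
    ∃ p : G.Walk u (u + k • c), p.length = k := by
  induction k generalizing u with
  | zero => exact ⟨Walk.nil.copy rfl (by simp), by simp⟩
  | succ k ih =>
    obtain ⟨p, hp⟩ := ih (u + c)
    exact ⟨(Walk.cons (h u) p).copy rfl (by rw [succ_nsmul']; abel), by simp [hp]⟩

theorem exists_walk_add_zsmul_s18 {M : Type*} [AddCommGroup M] {G : SimpleGraph M} {c : M}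
    (h : ∀ u, G.Adj u (u + c)) (k : ℤ) (u : M) :
    ∃ p : G.Walk u (u + k • c), p.length = k.natAbs := by
  have h' : ∀ u, G.Adj u (u + -c) := fun u => by simpa using (h (u + -c)).symm
  rcases Int.natAbs_eq k with hk | hk
  · obtain ⟨p, hp⟩ := exists_walk_add_nsmul_s18 h k.natAbs u
    exact ⟨p.copy rfl (by rw [← natCast_zsmul, ← hk]), (p.length_copy _ _).trans hp⟩
  · obtain ⟨p, hp⟩ := exists_walk_add_nsmul_s18 h' k.natAbs u
    refine ⟨p.copy rfl ?_, (p.length_copy _ _).trans hp⟩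
    rw [smul_neg, ← natCast_zsmul, ← neg_smul, ← hk]

theorem exists_walk_circulantGraph_pair {M : Type*} [AddCommGroup M] {c d : M}
    (hc : c ≠ 0) (hd : d ≠ 0) (a b : ℤ) (u : M) :
    ∃ p : (circulantGraph ({c, d} : Set M)).Walk u (u + a • c + b • d),
      p.length = a.natAbs + b.natAbs := by
  obtain ⟨p, hp⟩ := exists_walk_add_zsmul_s18 (G := circulantGraph ({c, d} : Set M)) (c := c)
    (fun u => by simp [circulantGraph_adj, hc]) a u
  obtain ⟨p', hp'⟩ := exists_walk_add_zsmul_s18 (G := circulantGraph ({c, d} : Set M)) (c := d)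
    (fun u => by simp [circulantGraph_adj, hd]) b (u + a • c)
  exact ⟨p.append p', by simp [hp, hp']⟩

theorem exists_zsmul_of_walk_circulantGraph_pair {M : Type*} [AddCommGroup M] {c d u v : M}
    (p : (circulantGraph ({c, d} : Set M)).Walk u v) :
    ∃ a b : ℤ, v = u + a • c + b • d ∧ a.natAbs + b.natAbs ≤ p.length := by
  induction p with
  | nil => exact ⟨0, 0, by simp, by simp⟩
  | @cons u w v h p ih =>
    obtain ⟨a, b, hv, hab⟩ := ih
    rw [Walk.length_cons]
    simp only [circulantGraph_adj, Set.mem_insert_iff, Set.mem_singleton_iff] at h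
    rcases h with ⟨-, (h | h) | h | h⟩
    · exact ⟨a - 1, b, by rw [hv, sub_smul, one_smul, ← h]; abel, by lia⟩
    · exact ⟨a, b - 1, by rw [hv, sub_smul, one_smul, ← h]; abel, by lia⟩
    · exact ⟨a + 1, b, by rw [hv, add_smul, one_smul, ← h]; abel, by lia⟩
    · exact ⟨a, b + 1, by rw [hv, add_smul, one_smul, ← h]; abel, by lia⟩

theorem mod_add_div_le_or_of_add_mul_eq {s x : ℕ} (hs : 0 < s) {a b : ℤ}
    (h : a + b * s = x) :
    x % s + x / s ≤ a.natAbs + b.natAbs ∨ 1 + s - x % s + x / s ≤ a.natAbs + b.natAbs := by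
  have hx : (x : ℤ) = (x % s : ℕ) + s * (x / s : ℕ) := by exact_mod_cast (Nat.mod_add_div x s).symm
  have hr := Nat.mod_lt x hs
  generalize x % s = r at *
  generalize x / s = q at *
  have ha : a = r + (q - b) * s := by linarith
  rcases le_or_gt b q with hb | hb
  · left
    have : (q - b : ℤ) * 1 ≤ (q - b) * s := mul_le_mul_of_nonneg_left (by lia) (by lia)
    lia
  · right
    have : (b - q - 1 : ℤ) * 1 ≤ (b - q - 1) * s := mul_le_mul_of_nonneg_left (by lia) (by lia)
    have : a = r - s - (b - q - 1) * s := by linarith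
    lia

theorem exists_add_mul_eq_of_mod_add_div {s x m : ℕ} (hs : 0 < s)
    (h : m = x % s + x / s ∨ m = 1 + s - x % s + x / s) :
    ∃ a b : ℤ, a + b * s = x ∧ a.natAbs + b.natAbs = m := by
  have hx : (x : ℤ) = (x % s : ℕ) + s * (x / s : ℕ) := by exact_mod_cast (Nat.mod_add_div x s).symm
  have hr := Nat.mod_lt x hs
  generalize x % s = r at *
  generalize x / s = q at *
  rcases h with h | h
  · exact ⟨r, q, by linarith, by lia⟩
  · exact ⟨r - s, q + 1, by linarith, by lia⟩

/-- Lowering `t` by a multiple of `s / gcd(n,s)` fixes the residue of `t * n + c` modulo `s` and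
does not increase the quotient. -/
theorem exists_le_div_gcd {n s t : ℕ} (hs : 0 < s) (ht : 1 ≤ t) :
    ∃ t' k : ℕ, 1 ≤ t' ∧ t' ≤ s / Nat.gcd n s ∧ t * n = t' * n + s * k := by
  have hpos : 0 < s / Nat.gcd n s :=
    Nat.div_pos (Nat.le_of_dvd hs (Nat.gcd_dvd_right n s)) (Nat.gcd_pos_of_pos_right n hs)
  have hsn : s / Nat.gcd n s * n = s * (n / Nat.gcd n s) := by
    rw [Nat.div_mul_right_comm (Nat.gcd_dvd_right n s), Nat.mul_div_assoc _ (Nat.gcd_dvd_left n s)]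
  generalize s / Nat.gcd n s = e at *
  generalize n / Nat.gcd n s = f at *
  refine ⟨(t - 1) % e + 1, f * ((t - 1) / e), by lia, Nat.mod_lt _ hpos, ?_⟩
  have h := Nat.mod_add_div (t - 1) e
  calc t * n = ((t - 1) % e + e * ((t - 1) / e) + 1) * n := by rw [h, Nat.sub_add_cancel ht]
    _ = ((t - 1) % e + 1) * n + (e * n) * ((t - 1) / e) := by ring
    _ = _ := by rw [hsn]; ring

/-- The distance `d(0,i)` in `C_n(1,s)` is the least element of the set of candidate
path lengths `r + q`, `1 + s - r + q`, and, for `1 ≤ t ≤ s / gcd(n,s)`,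
`r_t + q_t`, `1 + s - r_t + q_t`, `r̄_t + q̄_t`, `1 + s - r̄_t + q̄_t`. -/
theorem dist_circulant_eq_min (n s : ℕ) (hn : 5 ≤ n) (hs2 : 2 ≤ s) (hs : s ≤ (n - 1) / 2)
    (i : ℕ) (hi : i ≤ n - 1) :
    IsLeast
      { m : ℕ |
        m = i % s + i / s ∨
        m = 1 + s - i % s + i / s ∨
        ∃ t : ℕ, 1 ≤ t ∧ t ≤ s / Nat.gcd n s ∧
          (m = (t * n + i) % s + (t * n + i) / s ∨
           m = 1 + s - (t * n + i) % s + (t * n + i) / s ∨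
           m = (t * n - i) % s + (t * n - i) / s ∨
           m = 1 + s - (t * n - i) % s + (t * n - i) / s) }
      ((circulantGraph ({1, (s : ZMod n)} : Set (ZMod n))).dist 0 (i : ZMod n)) := by
  have hs0 : 0 < s := by lia
  have h1 : (1 : ZMod n) ≠ 0 := by
    have : Fact (1 < n) := ⟨by lia⟩
    exact one_ne_zero
  have hsn : (s : ZMod n) ≠ 0 := fun h =>
    absurd (Nat.le_of_dvd hs0 ((ZMod.natCast_eq_zero_iff s n).1 h)) (by lia)
  have hle : ∀ t : ℕ, 1 ≤ t → i ≤ t * n := fun t ht => by nlinarith [Nat.sub_le n 1]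
  have walk (a b : ℤ) (hab : (a : ZMod n) + b * s = i) :
      ∃ p : (circulantGraph ({1, (s : ZMod n)} : Set (ZMod n))).Walk 0 (i : ZMod n),
        p.length = a.natAbs + b.natAbs := by
    obtain ⟨p, hp⟩ := exists_walk_circulantGraph_pair h1 hsn a b 0
    exact ⟨p.copy rfl (by simpa using hab), by simpa using hp⟩
  have lower (x m : ℕ) (hx : (x : ZMod n) = i ∨ (x : ZMod n) = -i)
      (hm : m = x % s + x / s ∨ m = 1 + s - x % s + x / s) :
      (circulantGraph ({1, (s : ZMod n)} : Set (ZMod n))).dist 0 (i : ZMod n) ≤ m := by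
    obtain ⟨a, b, hab, rfl⟩ := exists_add_mul_eq_of_mod_add_div hs0 hm
    have hab' : (a : ZMod n) + b * s = x := by exact_mod_cast congrArg (Int.cast (R := ZMod n)) hab
    rcases hx with hx | hx
    · obtain ⟨p, hp⟩ := walk a b (hab'.trans hx)
      exact hp ▸ dist_le p
    · obtain ⟨p, hp⟩ := walk (-a) (-b) (by push_cast; linear_combination -hab' - hx)
      rw [Int.natAbs_neg, Int.natAbs_neg] at hp
      exact hp ▸ dist_le p
  refine (and_iff_right_of_imp ?_).2 ?_
  · intro hlb
    obtain ⟨p₀, -⟩ := walk i 0 (by simp)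
    obtain ⟨p, hp⟩ := p₀.reachable.exists_walk_length_eq_dist
    obtain ⟨a, b, hab, hlen⟩ := exists_zsmul_of_walk_circulantGraph_pair p
    rw [hp] at hlen
    suffices H : ∃ m ∈ _, m ≤ a.natAbs + b.natAbs by
      obtain ⟨m, hm, hml⟩ := H
      have := le_antisymm (hlb hm) (hml.trans hlen)
      exact this ▸ hm
    have hdvd : (n : ℤ) ∣ a + b * s - i := by
      rw [← ZMod.intCast_zmod_eq_zero_iff_dvd]
      push_cast
      rw [hab]
      simp
    obtain ⟨t, ht⟩ := hdvd
    rcases lt_trichotomy t 0 with h | rfl | h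
    · obtain ⟨t', k, ht', hts, htn⟩ := exists_le_div_gcd (n := n) (t := t.natAbs) hs0 (by lia)
      have hx : -a + -b * s = ((t' * n - i + s * k : ℕ) : ℤ) := by
        have htn' : (t.natAbs : ℤ) * n = t' * n + s * k := by exact_mod_cast htn
        rw [Int.ofNat_natAbs_of_nonpos h.le] at htn'
        push_cast [Nat.cast_sub (hle t' ht')]
        linear_combination -ht + htn'
      have := mod_add_div_le_or_of_add_mul_eq hs0 hx
      rw [Nat.add_mul_mod_self_left, Nat.add_mul_div_left _ _ hs0, Int.natAbs_neg,
        Int.natAbs_neg] at this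
      rcases this with h | h
      · exact ⟨_, Or.inr (Or.inr ⟨t', ht', hts, Or.inr (Or.inr (Or.inl rfl))⟩), by lia⟩
      · exact ⟨_, Or.inr (Or.inr ⟨t', ht', hts, Or.inr (Or.inr (Or.inr rfl))⟩), by lia⟩
    · rcases mod_add_div_le_or_of_add_mul_eq (x := i) (a := a) (b := b) hs0 (by linarith) with h | h
      · exact ⟨_, Or.inl rfl, h⟩
      · exact ⟨_, Or.inr (Or.inl rfl), h⟩
    · obtain ⟨t', k, ht', hts, htn⟩ := exists_le_div_gcd (n := n) (t := t.natAbs) hs0 (by lia)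
      have hx : a + b * s = ((t' * n + i + s * k : ℕ) : ℤ) := by
        have htn' : (t.natAbs : ℤ) * n = t' * n + s * k := by exact_mod_cast htn
        rw [Int.natAbs_of_nonneg h.le] at htn'
        push_cast
        linear_combination ht + htn'
      have := mod_add_div_le_or_of_add_mul_eq hs0 hx
      rw [Nat.add_mul_mod_self_left, Nat.add_mul_div_left _ _ hs0] at this
      rcases this with h | h
      · exact ⟨_, Or.inr (Or.inr ⟨t', ht', hts, Or.inl rfl⟩), by lia⟩
      · exact ⟨_, Or.inr (Or.inr ⟨t', ht', hts, Or.inr (Or.inl rfl)⟩), by lia⟩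
  · rintro m (hm | hm | ⟨t, ht, -, hm⟩)
    · exact lower i m (Or.inl rfl) (Or.inl hm)
    · exact lower i m (Or.inl rfl) (Or.inr hm)
    · rw [← or_assoc] at hm
      rcases hm with hm | hm
      · exact lower _ m (Or.inl (by simp)) hm
      · exact lower _ m (Or.inr (by simp [Nat.cast_sub (hle t ht)])) hm
end

section
/- Let n ≥ 5 and s be integers with 2 ≤ s ≤ ⌊(n−1)/2⌋, let i be an integer with 0 ≤ i ≤ n−1 regarded as a vertex of C_n(1,s), and let t be an integer with 1 ≤ t ≤ s/gcd(n,s). Set q = ⌊i/s⌋, r = i mod s, q_t = ⌊(t·n+i)/s⌋, r_t = (t·n+i) mod s, q̄_t = ⌊(t·n−i)/s⌋, r̄_t = (t·n−i) mod s. Then the distance d(0,i) in C_n(1,s) satisfies each of the following upper bounds: d(0,i) ≤ r + q, d(0,i) ≤ 1 + s − r + q, d(0,i) ≤ r_t + q_t, d(0,i) ≤ 1 + s − r_t + q_t, d(0,i) ≤ r̄_t + q̄_t, and d(0,i) ≤ 1 + s − r̄_t + q̄_t. -/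
open SimpleGraph

namespace SimpleGraph

variable {A : Type*} [AddGroup A] {X : Set A}

/-- Repeating the jump `g` at most `k` times joins `a` to `k • g + a` in a circulant graph. -/
theorem exists_walk_circulantGraph_nsmul {g : A} (hg : g ∈ X ∨ -g ∈ X) (a : A) (k : ℕ) :
    ∃ p : (circulantGraph X).Walk a (k • g + a), p.length ≤ k := by
  induction k with
  | zero => exact ⟨Walk.nil.copy rfl (by simp), by simp⟩
  | succ k ih =>
    obtain ⟨p, hp⟩ := ih
    have hstep : (k + 1) • g + a = g + (k • g + a) := by rw [succ_nsmul', add_assoc]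
    by_cases h0 : g = 0
    · exact ⟨p.copy rfl (by simp [h0]), by simpa using hp.trans k.le_succ⟩
    · have hadj : (circulantGraph X).Adj (k • g + a) ((k + 1) • g + a) := by
        rw [hstep, circulantGraph, fromRel_adj]
        refine ⟨by simpa using h0, ?_⟩
        rw [add_sub_cancel_right, ← neg_sub, add_sub_cancel_right]
        exact hg.symm
      exact ⟨p.concat hadj, by simpa using hp⟩

/-- Jumps `g` and `h`, repeated `k` and `l` times, bound a distance in a circulant graph. -/
theorem dist_circulantGraph_le_add {g h : A} (hg : g ∈ X ∨ -g ∈ X) (hh : h ∈ X ∨ -h ∈ X)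
    {a b : A} {k l : ℕ} (hb : b = l • h + (k • g + a)) :
    (circulantGraph X).dist a b ≤ k + l := by
  subst hb
  obtain ⟨p, hp⟩ := exists_walk_circulantGraph_nsmul hg a k
  obtain ⟨q, hq⟩ := exists_walk_circulantGraph_nsmul hh (k • g + a) l
  exact (dist_le (p.append q)).trans (by rw [Walk.length_append]; lia)

theorem dist_circulantGraph_le_mod_add_div {R : Type*} [Ring R] (s m : ℕ) (a : R) :
    (circulantGraph ({1, (s : R)} : Set R)).dist a (m + a) ≤ m % s + m / s := by
  refine dist_circulantGraph_le_add (g := (1 : R)) (h := (s : R)) (by simp) (by simp) ?_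
  have hm : ((m / s * s + m % s : ℕ) : R) = m := by rw [Nat.div_add_mod']
  rw [← hm]
  push_cast
  simp [nsmul_eq_mul, add_assoc]

theorem dist_circulantGraph_le_sub_mod_add_div {R : Type*} [Ring R] {s : ℕ} (hs : 0 < s)
    (m : ℕ) (a : R) :
    (circulantGraph ({1, (s : R)} : Set R)).dist a (m + a) ≤ 1 + s - m % s + m / s := by
  have hr := Nat.mod_lt m hs
  have hlen : 1 + s - m % s + m / s = (s - m % s) + (m / s + 1) := by lia
  rw [hlen]
  refine dist_circulantGraph_le_add (g := (-1 : R)) (h := (s : R)) (by simp) (by simp) ?_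
  have hm : ((m / s * s + m % s : ℕ) : R) = m := by rw [Nat.div_add_mod']
  rw [← hm, nsmul_eq_mul, nsmul_eq_mul, Nat.cast_sub hr.le]
  push_cast
  noncomm_ring

end SimpleGraph

/-- For `1 ≤ t ≤ s / gcd(n,s)`, the distance `d(0,i)` in `C_n(1,s)` is bounded above by
each of `r + q`, `1 + s - r + q`, `r_t + q_t`, `1 + s - r_t + q_t`, `r̄_t + q̄_t`, and
`1 + s - r̄_t + q̄_t`. -/
theorem dist_circulant_le_paths (n s : ℕ) (hn : 5 ≤ n) (hs2 : 2 ≤ s) (hs : s ≤ (n - 1) / 2)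
    (i : ℕ) (hi : i ≤ n - 1) (t : ℕ) (ht1 : 1 ≤ t) (ht2 : t ≤ s / Nat.gcd n s) :
    (circulantGraph ({1, (s : ZMod n)} : Set (ZMod n))).dist 0 (i : ZMod n) ≤ i % s + i / s ∧
    (circulantGraph ({1, (s : ZMod n)} : Set (ZMod n))).dist 0 (i : ZMod n) ≤
      1 + s - i % s + i / s ∧
    (circulantGraph ({1, (s : ZMod n)} : Set (ZMod n))).dist 0 (i : ZMod n) ≤
      (t * n + i) % s + (t * n + i) / s ∧
    (circulantGraph ({1, (s : ZMod n)} : Set (ZMod n))).dist 0 (i : ZMod n) ≤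
      1 + s - (t * n + i) % s + (t * n + i) / s ∧
    (circulantGraph ({1, (s : ZMod n)} : Set (ZMod n))).dist 0 (i : ZMod n) ≤
      (t * n - i) % s + (t * n - i) / s ∧
    (circulantGraph ({1, (s : ZMod n)} : Set (ZMod n))).dist 0 (i : ZMod n) ≤
      1 + s - (t * n - i) % s + (t * n - i) / s := by
  have hs0 : 0 < s := by lia
  have hfwd : ((t * n + i : ℕ) : ZMod n) + 0 = i := by simp
  have hle : i ≤ t * n := by nlinarith [Nat.sub_le n 1]
  have hbwd : ((t * n - i : ℕ) : ZMod n) + i = 0 := by simp [Nat.cast_sub hle]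
  refine ⟨?_, ?_, ?_, ?_, ?_, ?_⟩
  · simpa using dist_circulantGraph_le_mod_add_div s i (0 : ZMod n)
  · simpa using dist_circulantGraph_le_sub_mod_add_div hs0 i (0 : ZMod n)
  · simpa only [hfwd] using dist_circulantGraph_le_mod_add_div s (t * n + i) (0 : ZMod n)
  · simpa only [hfwd] using dist_circulantGraph_le_sub_mod_add_div hs0 (t * n + i) (0 : ZMod n)
  · simpa only [hbwd, dist_comm (v := (0 : ZMod n))] using
      dist_circulantGraph_le_mod_add_div s (t * n - i) (i : ZMod n)
  · simpa only [hbwd, dist_comm (v := (0 : ZMod n))] using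
      dist_circulantGraph_le_sub_mod_add_div hs0 (t * n - i) (i : ZMod n)
end
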